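/- arXiv:2403.16840 — 2 statements merged into one kernel-verified Lean document; each statement's English description precedes it below -/
import Mathlib

section
/- Let m,n be positive integers with (m,n) ≠ (1,1) and d = m+n. For every ε > 0 there exist constants ρ_ε, η_ε > 0 and t_ε ∈ ℕ such that the Hausdorff dimension of the set {A ∈ M_{m,n}(ℝ) : ρ_ε ≤ λ₁(a_t u_A ℤ^d) ≤ η_ε for all t ≥ t_ε} is at least mn − mn/(m+n) − ε. Moreover, ρ_ε and η_ε can be chosen so that ρ_ε → 0 and η_ε → 0 as ε → 0. -/
open MeasureTheory Matrix ENNReal Filter Topology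

noncomputable section

/-- The supremum norm of a matrix (the maximum of the absolute values of its entries),
obtained from the sup norm on the corresponding function space. -/
def supNorm {p q : ℕ} (M : Matrix (Fin p) (Fin q) ℝ) : ℝ := ‖(Matrix.of.symm M)‖

/-- The diagonal element `a_t = diag(e^{t/m} I_m, e^{-t/n} I_n)`. -/
def aMat (m n : ℕ) (t : ℝ) : Matrix (Fin (m + n)) (Fin (m + n)) ℝ :=
  Matrix.reindex finSumFinEquiv finSumFinEquiv
    (Matrix.fromBlocks (Real.exp (t / m) • (1 : Matrix (Fin m) (Fin m) ℝ)) 0 0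
      (Real.exp (-(t / n)) • (1 : Matrix (Fin n) (Fin n) ℝ)))

/-- The unipotent element `u_A` with upper-right block `A`. -/
def uMat (m n : ℕ) (A : Fin m → Fin n → ℝ) : Matrix (Fin (m + n)) (Fin (m + n)) ℝ :=
  Matrix.reindex finSumFinEquiv finSumFinEquiv
    (Matrix.fromBlocks 1 (Matrix.of A) 0 1)

lemma uMat_det (m n : ℕ) (A : Fin m → Fin n → ℝ) : (uMat m n A).det = 1 := by
  simp [uMat, Matrix.det_fromBlocks_zero₂₁]

lemma aMat_det (m n : ℕ) (hm : 0 < m) (hn : 0 < n) (t : ℝ) : (aMat m n t).det = 1 := by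
  have hm' : (m : ℝ) ≠ 0 := Nat.cast_ne_zero.mpr hm.ne'
  have hn' : (n : ℝ) ≠ 0 := Nat.cast_ne_zero.mpr hn.ne'
  simp only [aMat, Matrix.det_reindex_self, Matrix.det_fromBlocks_zero₂₁,
    Matrix.det_smul, Matrix.det_one, Fintype.card_fin, mul_one]
  rw [← Real.exp_nat_mul, ← Real.exp_nat_mul, ← Real.exp_add]
  rw [mul_div_cancel₀ _ hm']
  rw [show (n : ℝ) * -(t / n) = -t by field_simp [mul_comm]]
  simp

/-- `a_t` as an element of `SL_{m+n}(ℝ)`. -/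
def aSL (m n : ℕ) (hm : 0 < m) (hn : 0 < n) (t : ℝ) :
    Matrix.SpecialLinearGroup (Fin (m + n)) ℝ :=
  ⟨aMat m n t, aMat_det m n hm hn t⟩

/-- `u_A` as an element of `SL_{m+n}(ℝ)`. -/
def uSL (m n : ℕ) (A : Fin m → Fin n → ℝ) : Matrix.SpecialLinearGroup (Fin (m + n)) ℝ :=
  ⟨uMat m n A, uMat_det m n A⟩

instance SLtop (d : ℕ) : TopologicalSpace (Matrix.SpecialLinearGroup (Fin d) ℝ) :=
  instTopologicalSpaceSubtype

/-- `SL_d(ℤ)` viewed as a subgroup of `SL_d(ℝ)`. -/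
def Gamma (d : ℕ) : Subgroup (Matrix.SpecialLinearGroup (Fin d) ℝ) :=
  (Matrix.SpecialLinearGroup.map (n := Fin d) (Int.castRingHom ℝ)).range

/-- The space of unimodular lattices `X_d = SL_d(ℝ)/SL_d(ℤ)`. -/
abbrev XSp (d : ℕ) := Matrix.SpecialLinearGroup (Fin d) ℝ ⧸ Gamma d

instance (d : ℕ) : MeasurableSpace (XSp d) := borel _

/-- The first successive minimum `λ₁` of the lattice `g ℤ^d` (with respect to the sup norm):
the infimum of all `r` such that the lattice contains a nonzero vector of norm at most `r`. -/
def lam1M (d : ℕ) (g : Matrix (Fin d) (Fin d) ℝ) : ℝ :=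
  sInf {r : ℝ | ∃ v : Fin d → ℤ, v ≠ 0 ∧ ‖g.mulVec (fun i => (v i : ℝ))‖ ≤ r}

/-- The first successive minimum `λ₁` of a unimodular lattice `x ∈ X_d`. -/
def lam1X (d : ℕ) (x : XSp d) : ℝ :=
  sInf {r : ℝ | ∃ g : Matrix.SpecialLinearGroup (Fin d) ℝ,
    (QuotientGroup.mk g : XSp d) = x ∧
    ∃ v : Fin d → ℤ, v ≠ 0 ∧
      ‖(g : Matrix (Fin d) (Fin d) ℝ).mulVec (fun i => (v i : ℝ))‖ ≤ r}

/-- The lattice `g ℤ^d` as a subset of `ℝ^d`. -/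
def latticeSet (d : ℕ) (g : Matrix (Fin d) (Fin d) ℝ) : Set (Fin d → ℝ) :=
  Set.range fun v : Fin d → ℤ => g.mulVec (fun i => (v i : ℝ))

/-- Shannon entropy of a finite indexed partition with respect to a measure. -/
def partEnt {α : Type*} [MeasurableSpace α] (μ : Measure α) {ι : Type*} [Fintype ι]
    (P : ι → Set α) : ℝ :=
  ∑ i, Real.negMulLog (μ (P i)).toReal

/-- The join `⋁_{j<N} T^{-j} P` of a finite partition, indexed by itineraries. -/
def joinPart {α : Type*} (T : α → α) {k : ℕ} (P : Fin k → Set α) (N : ℕ) :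
    (Fin N → Fin k) → Set α :=
  fun ω => ⋂ j : Fin N, T^[(j : ℕ)] ⁻¹' P (ω j)

/-- A finite measurable partition of the space. -/
def IsFinPart {α : Type*} [MeasurableSpace α] {k : ℕ} (P : Fin k → Set α) : Prop :=
  (∀ i, MeasurableSet (P i)) ∧ Pairwise (Function.onFun Disjoint P) ∧ (⋃ i, P i) = Set.univ

/-- Kolmogorov–Sinai (measure-theoretic) entropy of a transformation `T` with respect to `μ`:
the supremum over finite measurable partitions `P` of `inf_N H_μ(⋁_{j<N} T^{-j}P)/N`. -/
def ksEntropy {α : Type*} [MeasurableSpace α] (T : α → α) (μ : Measure α) : ℝ :=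
  ⨆ (k : ℕ) (P : Fin k → Set α) (_ : IsFinPart P),
    ⨅ N : ℕ, partEnt μ (joinPart T P (N + 1)) / (N + 1)

/-- The time-one map `x ↦ a x` on the space of lattices `X_{m+n}`. -/
def aAct (m n : ℕ) (hm : 0 < m) (hn : 0 < n) : XSp (m + n) → XSp (m + n) :=
  fun x => aSL m n hm hn 1 • x

/-- The (topological) support of a measure: points all of whose open neighborhoods have
positive measure. -/
def μsupport {α : Type*} [TopologicalSpace α] [MeasurableSpace α] (μ : Measure α) : Set α :=
  {x | ∀ U : Set α, IsOpen U → x ∈ U → 0 < μ U}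

/-- Integer vector viewed as a real vector. -/
def ic {ι : Type*} (z : ι → ℤ) : ι → ℝ := fun i => (z i : ℝ)

lemma ic_ne_zero {ι : Type*} {z : ι → ℤ} (hz : z ≠ 0) : ic z ≠ 0 := by
  intro h
  apply hz
  funext i
  have := congrFun h i
  simpa [ic] using this

lemma ic_sub {ι : Type*} (z w : ι → ℤ) : ic (z - w) = ic z - ic w := by
  funext i; simp [ic]

lemma ic_add {ι : Type*} (z w : ι → ℤ) : ic (z + w) = ic z + ic w := by
  funext i; simp [ic]

lemma ic_smul {ι : Type*} (k : ℤ) (w : ι → ℤ) : ic (k • w) = (k : ℝ) • ic w := by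
  funext i; simp [ic]

lemma ic_inj {ι : Type*} {z w : ι → ℤ} (h : ic z = ic w) : z = w := by
  funext i
  have := congrFun h i
  simpa [ic] using this

lemma det_updateRow_one' {ι : Type*} [Fintype ι] [DecidableEq ι] (i : ι) (f : ι → ℝ) :
    ((1 : Matrix ι ι ℝ).updateRow i f).det = f i := by
  rw [← cramer_transpose_apply]
  simp [cramer_one]

lemma updateRow_one_mulVec_same {ι : Type*} [Fintype ι] [DecidableEq ι] (i : ι) (f u : ι → ℝ) :
    (((1 : Matrix ι ι ℝ).updateRow i f) *ᵥ u) i = ∑ j, f j * u j := by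
  simp [mulVec, dotProduct]

lemma updateRow_one_mulVec_ne {ι : Type*} [Fintype ι] [DecidableEq ι] {i k : ι} (h : k ≠ i)
    (f u : ι → ℝ) :
    (((1 : Matrix ι ι ℝ).updateRow i f) *ᵥ u) k = u k := by
  simp [mulVec, dotProduct, updateRow_ne h, Matrix.one_apply]

lemma mem_intspan {ι : Type*} [Fintype ι] {x : ι → ℝ}
    (hx : x ∈ (Submodule.span ℤ (Set.range (Pi.basisFun ℝ ι)))) : ∃ z : ι → ℤ, x = ic z := by
  classical
  rw [Module.Basis.mem_span_iff_repr_mem] at hx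
  choose z hz using hx
  refine ⟨z, ?_⟩
  funext i
  have := hz i
  simp at this
  simp [ic, this]

lemma ic_mem_intspan {ι : Type*} [Fintype ι] (z : ι → ℤ) :
    ic z ∈ (Submodule.span ℤ (Set.range (Pi.basisFun ℝ ι))) := by
  classical
  rw [Module.Basis.mem_span_iff_repr_mem]
  intro i
  simp [ic]

lemma vol_fd {ι : Type*} [Fintype ι] :
    volume (ZSpan.fundamentalDomain (Pi.basisFun ℝ ι)) = 1 := by
  classical
  rw [ZSpan.volume_fundamentalDomain]
  have : (Matrix.of ⇑(Pi.basisFun ℝ ι)) = 1 := by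
    ext i j
    simp [Matrix.one_apply, Pi.single_apply, eq_comm]
  rw [this]; simp

/-- The Minkowski theorem on linear forms. -/
lemma minkowski_forms {ι : Type*} [Fintype ι] [DecidableEq ι] [Nonempty ι] (M : Matrix ι ι ℝ)
    (hM : M.det ≠ 0) (c : ι → ℝ) (hc : ∀ i, 0 ≤ c i) (h : |M.det| ≤ ∏ i, c i) :
    ∃ z : ι → ℤ, z ≠ 0 ∧ ∀ i, |(M *ᵥ (ic z)) i| ≤ c i := by
  have hdet : LinearMap.det (Matrix.toLin' M) ≠ 0 := by rwa [LinearMap.det_toLin']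
  let e : (ι → ℝ) ≃ₗ[ℝ] (ι → ℝ) := LinearMap.equivOfDetNeZero _ hdet
  let K : Set (ι → ℝ) := Set.Icc (-c) c
  let s : Set (ι → ℝ) := (Matrix.toLin' M) ⁻¹' K
  have hs : volume s = ENNReal.ofReal |(M.det)⁻¹| * volume K := by
    have := Measure.addHaar_preimage_linearMap (volume : Measure (ι → ℝ)) hdet K
    rw [LinearMap.det_toLin'] at this
    exact this
  have hK : volume K = ENNReal.ofReal (2 ^ Fintype.card ι * ∏ i, c i) := by
    rw [Real.volume_Icc_pi, ← ENNReal.ofReal_prod_of_nonneg]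
    · congr 1
      rw [← Finset.card_univ, ← Finset.prod_const, ← Finset.prod_mul_distrib]
      apply Finset.prod_congr rfl
      intro i _
      simp; ring
    · intro i _
      simp
      linarith [hc i]
  have hcpt : IsCompact s := by
    have : s = e.symm '' K := by
      rw [LinearEquiv.image_symm_eq_preimage]
      rfl
    rw [this]
    exact isCompact_Icc.image (e.symm.toLinearMap.continuous_of_finiteDimensional)
  have hconv : Convex ℝ s := (convex_Icc _ _).linear_preimage _
  have hsymm : ∀ x ∈ s, -x ∈ s := by
    intro x hx
    simp only [s, K, Set.mem_preimage, map_neg, Set.mem_Icc] at hx ⊢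
    exact ⟨neg_le_neg hx.2, by simpa using neg_le_neg hx.1⟩
  have fund := ZSpan.isAddFundamentalDomain' (Pi.basisFun ℝ ι) (volume : Measure (ι → ℝ))
  have : Countable (Submodule.span ℤ (Set.range (Pi.basisFun ℝ ι))).toAddSubgroup := by
    have : Function.Surjective (fun z : ι → ℤ => (⟨ic z, ic_mem_intspan z⟩ :
        (Submodule.span ℤ (Set.range (Pi.basisFun ℝ ι))).toAddSubgroup)) := by
      intro x
      obtain ⟨z, hz⟩ := mem_intspan x.2
      exact ⟨z, Subtype.ext hz.symm⟩
    exact this.countable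
  have key := exists_ne_zero_mem_lattice_of_measure_mul_two_pow_le_measure
    (L := (Submodule.span ℤ (Set.range (Pi.basisFun ℝ ι))).toAddSubgroup) (μ := volume)
    (F := ZSpan.fundamentalDomain (Pi.basisFun ℝ ι)) (s := s) fund hsymm hconv hcpt ?_
  · obtain ⟨x, hx0, hx⟩ := key
    obtain ⟨z, hz⟩ := mem_intspan x.2
    refine ⟨z, ?_, ?_⟩
    · rintro rfl
      apply hx0
      ext i
      rw [hz]; simp [ic]
    · intro i
      rw [hz] at hx
      simp only [s, K, Set.mem_preimage, Set.mem_Icc, Matrix.toLin'_apply] at hx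
      rw [abs_le]
      exact ⟨hx.1 i, hx.2 i⟩
  · rw [vol_fd, one_mul, Module.finrank_fintype_fun_eq_card, hs, hK,
      ← ENNReal.ofReal_mul (abs_nonneg _)]
    have : (2 : ℝ≥0∞) ^ Fintype.card ι = ENNReal.ofReal (2 ^ Fintype.card ι) := by
      rw [ENNReal.ofReal_pow (by norm_num)]; simp
    rw [this]
    apply ENNReal.ofReal_le_ofReal
    rw [abs_inv]
    have hpos : 0 < |M.det| := abs_pos.mpr hM
    rw [inv_mul_eq_div, le_div_iff₀ hpos]
    gcongr

/-- Sum over a lattice bounded by an integral. -/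
lemma sum_le_lintegral {ι : Type*} [Fintype ι] [DecidableEq ι] (g : Matrix ι ι ℝ)
    (hg : g.det = 1) (D : ℝ) (hD : ∀ x : ι → ℝ, ∃ z : ι → ℤ, ‖g *ᵥ (x - ic z)‖ ≤ D)
    (F : (ι → ℤ) → ℝ≥0∞) (G : (ι → ℝ) → ℝ≥0∞) (hG : Measurable G)
    (hFG : ∀ z δ, ‖δ‖ ≤ D → F z ≤ G (g *ᵥ (ic z) + δ)) :
    ∑' z, F z ≤ ∫⁻ u, G u := by
  have hdet : LinearMap.det (Matrix.toLin' g) ≠ 0 := by rw [LinearMap.det_toLin', hg]; norm_num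
  have hmap : Measure.map (Matrix.toLin' g) (volume : Measure (ι → ℝ)) = volume := by
    rw [Real.map_linearMap_volume_pi_eq_smul_volume_pi hdet, LinearMap.det_toLin', hg]; simp
  have hmeas : Measurable (Matrix.toLin' g) :=
    (LinearMap.continuous_of_finiteDimensional _).measurable
  have fund := ZSpan.isAddFundamentalDomain' (Pi.basisFun ℝ ι) (volume : Measure (ι → ℝ))
  have h1 : ∫⁻ u, G u = ∫⁻ x, G (g *ᵥ x) := by
    conv_lhs => rw [← hmap]
    rw [lintegral_map hG hmeas]
    rfl
  have hmg : Measurable fun x : ι → ℝ => G (g *ᵥ x) := hG.comp hmeas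
  let Λ := (Submodule.span ℤ (Set.range (Pi.basisFun ℝ ι))).toAddSubgroup
  let Fd := ZSpan.fundamentalDomain (Pi.basisFun ℝ ι)
  let eq : (ι → ℤ) ≃ Λ := Equiv.ofBijective (fun z => ⟨ic z, ic_mem_intspan z⟩)
    ⟨fun a b h => ic_inj (by simpa using h), fun x => by
      obtain ⟨z, hz⟩ := mem_intspan x.2
      exact ⟨z, Subtype.ext hz.symm⟩⟩
  have : Countable Λ := eq.symm.injective.countable
  rw [h1, fund.lintegral_eq_tsum'' (fun x => G (g *ᵥ x))]
  have h2 : ∑' v : Λ, ∫⁻ x in Fd, G (g *ᵥ (v +ᵥ x)) =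
      ∑' z : ι → ℤ, ∫⁻ x in Fd, G (g *ᵥ (ic z + x)) := by
    rw [← eq.tsum_eq]
    rfl
  have h3 : ∑' z : ι → ℤ, ∫⁻ x in Fd, G (g *ᵥ (ic z + x)) =
      ∫⁻ x in Fd, ∑' z : ι → ℤ, G (g *ᵥ (ic z + x)) := by
    rw [lintegral_tsum]
    intro z
    exact (hmg.comp (measurable_const_add _)).aemeasurable
  refine le_trans ?_ (h2.trans h3).ge
  calc ∑' z, F z = ∫⁻ x in Fd, ∑' z, F z := by
        rw [setLIntegral_const]
        simp only [Fd]
        rw [vol_fd, mul_one]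
    _ ≤ _ := by
        apply lintegral_mono
        intro x
        obtain ⟨z0, hz0⟩ := hD x
        have : ∑' z : ι → ℤ, G (g *ᵥ (ic z + x)) = ∑' z : ι → ℤ, G (g *ᵥ (ic (z - z0) + x)) :=
          ((Equiv.subRight z0).tsum_eq (fun z => G (g *ᵥ (ic z + x)))).symm
        simp only [this]
        apply ENNReal.tsum_le_tsum
        intro z
        have := hFG z _ hz0
        convert this using 2
        rw [ic_sub, ← mulVec_add]
        congr 1
        abel

/-- A lower bound on the first minimum bounds the covering radius. -/
lemma covering {ι : Type*} [Fintype ι] [DecidableEq ι] [Nonempty ι] (ρ : ℝ) (hρ : 0 < ρ) :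
    ∃ D : ℝ, 1 ≤ D ∧ ∀ g : Matrix ι ι ℝ, g.det = 1 → (∀ z : ι → ℤ, z ≠ 0 → ρ ≤ ‖g *ᵥ ic z‖) →
      ∀ x : ι → ℝ, ∃ z : ι → ℤ, ‖g *ᵥ (x - ic z)‖ ≤ D := by
  set d : ℝ := ((Fintype.card ι : ℕ) : ℝ) with hd
  have hd1 : (1:ℝ) ≤ d := by
    rw [hd]; exact_mod_cast Fintype.card_pos
  set a : ℝ := ρ / (2 * d) with ha
  have ha0 : 0 < a := by positivity
  set M' : ℝ := (a ^ (Fintype.card ι - 1))⁻¹ with hM'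
  have hM'0 : 0 < M' := by positivity
  set M : ℝ := M' + ρ with hMdef
  refine ⟨max 1 (d * M), le_max_left _ _, ?_⟩
  intro g hg hlam
  have hginj : ∀ u : ι → ℝ, g *ᵥ (g⁻¹ *ᵥ u) = u := by
    intro u
    rw [mulVec_mulVec, Matrix.mul_nonsing_inv _ (by rw [hg]; exact isUnit_one), one_mulVec]
  let X : Set (ι → ℝ) := {u | ∃ z : ι → ℤ, u = g *ᵥ ic z ∧ ‖u‖ ≤ M}
  have hspan : Submodule.span ℝ X = ⊤ := by
    by_contra hne
    obtain ⟨f, hf0, hf⟩ := Submodule.exists_le_ker_of_lt_top _ (lt_top_iff_ne_top.mpr hne)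
    -- coefficients
    let c : ι → ℝ := fun j => f (Pi.single j 1)
    have hfc : ∀ u : ι → ℝ, f u = ∑ j, c j * u j := by
      intro u
      conv_lhs => rw [pi_eq_sum_univ' u]
      simp [c, mul_comm]
    obtain ⟨i, -, hi⟩ := Finset.exists_max_image Finset.univ (fun j => |c j|) Finset.univ_nonempty
    have hci : c i ≠ 0 := by
      intro h0
      apply hf0
      ext j
      have := hi j (Finset.mem_univ _)
      rw [h0] at this
      simpa [c] using this
    let f' : ι → ℝ := fun j => c j / c i
    have hf'i : f' i = 1 := div_self hci
    have hf'le : ∀ j, |f' j| ≤ 1 := by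
      intro j
      simp only [f', abs_div]
      exact div_le_one_of_le₀ (hi j (Finset.mem_univ _)) (abs_nonneg _)
    let E : Matrix ι ι ℝ := (1 : Matrix ι ι ℝ).updateRow i f'
    have hE : E.det = 1 := by rw [det_updateRow_one', hf'i]
    obtain ⟨z, hz0, hz⟩ := minkowski_forms (E * g) (by rw [det_mul, hE, hg]; norm_num)
      (fun j => if j = i then M' else a) (by intro j; split_ifs <;> positivity) (by
        rw [det_mul, hE, hg]
        rw [Finset.prod_ite]
        simp only [Finset.prod_const]
        have h1 : (Finset.univ.filter (fun j => j = i)).card = 1 := by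
          rw [Finset.filter_eq']; simp
        have h2 : (Finset.univ.filter (fun j => ¬ j = i)).card = Fintype.card ι - 1 := by
          rw [Finset.filter_ne', Finset.card_erase_of_mem (Finset.mem_univ _)]; rfl
        rw [h1, h2, pow_one, hM', inv_mul_cancel₀ (by positivity)]
        norm_num)
    set u := g *ᵥ ic z with hu
    have hother : ∀ j, j ≠ i → |u j| ≤ a := by
      intro j hj
      have := hz j
      rw [if_neg hj, ← mulVec_mulVec, updateRow_one_mulVec_ne hj] at this
      exact this
    have hsum : |∑ j, f' j * u j| ≤ M' := by
      have := hz i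
      rw [if_pos rfl, ← mulVec_mulVec, updateRow_one_mulVec_same] at this
      exact this
    have hrest : |∑ j ∈ Finset.univ.erase i, f' j * u j| ≤ d * a := by
      calc |∑ j ∈ Finset.univ.erase i, f' j * u j| ≤ ∑ j ∈ Finset.univ.erase i, |f' j * u j| :=
            Finset.abs_sum_le_sum_abs _ _
        _ ≤ ∑ j ∈ Finset.univ.erase i, a := by
            apply Finset.sum_le_sum
            intro j hj
            rw [abs_mul]
            have := hother j (Finset.ne_of_mem_erase hj)
            have := hf'le j
            nlinarith [abs_nonneg (f' j), abs_nonneg (u j)]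
        _ ≤ ∑ j : ι, a := Finset.sum_le_sum_of_subset_of_nonneg (Finset.erase_subset _ _)
            (fun _ _ _ => ha0.le)
        _ = d * a := by simp [hd]
    have hsplit : ∑ j, f' j * u j = u i + ∑ j ∈ Finset.univ.erase i, f' j * u j := by
      rw [← Finset.add_sum_erase _ _ (Finset.mem_univ i), hf'i, one_mul]
    have hda : d * a = ρ / 2 := by rw [ha]; field_simp
    have hale : a ≤ ρ / 2 := by rw [← hda]; nlinarith
    have hui : |u i| ≤ |∑ j, f' j * u j| + ρ / 2 := by
      have : u i = ∑ j, f' j * u j - ∑ j ∈ Finset.univ.erase i, f' j * u j := by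
        rw [hsplit]; ring
      rw [this]
      exact (abs_sub _ _).trans (by rw [← hda]; gcongr)
    have hnz : ∑ j, f' j * u j = 0 := by
      have hmem : u ∈ X := by
        refine ⟨z, rfl, ?_⟩
        rw [pi_norm_le_iff_of_nonneg (by positivity)]
        intro j
        rw [Real.norm_eq_abs]
        by_cases hj : j = i
        · subst hj
          linarith
        · linarith [hother j hj]
      have : f u = 0 := by
        have := hf (Submodule.subset_span hmem)
        simpa using this
      rw [hfc] at this
      simp only [f', div_mul_eq_mul_div]
      rw [← Finset.sum_div, this, zero_div]
    have : ‖u‖ ≤ ρ / 2 := by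
      rw [pi_norm_le_iff_of_nonneg (by positivity)]
      intro j
      rw [Real.norm_eq_abs]
      by_cases hj : j = i
      · subst hj
        rw [hnz] at hui
        simpa using hui
      · linarith [hother j hj]
    linarith [hlam z hz0]
  obtain ⟨Y, hYX, hYspan, hYind⟩ := exists_linearIndependent ℝ X
  rw [hspan] at hYspan
  let b : Module.Basis Y ℝ (ι → ℝ) := Module.Basis.mk hYind (by simp [hYspan])
  have : Fintype Y := FiniteDimensional.fintypeBasisIndex b
  have hcard : Fintype.card Y = Fintype.card ι := by
    rw [← Module.finrank_eq_card_basis b, Module.finrank_fintype_fun_eq_card]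
  intro x
  have hch : ∀ y : Y, ∃ z : ι → ℤ, (y : ι → ℝ) = g *ᵥ ic z ∧ ‖(y : ι → ℝ)‖ ≤ M :=
    fun y => hYX y.2
  choose zz hzz hzn using hch
  refine ⟨∑ y, ⌊b.repr (g *ᵥ x) y⌋ • zz y, ?_⟩
  have hic : g *ᵥ ic (∑ y, ⌊b.repr (g *ᵥ x) y⌋ • zz y) =
      ∑ y, (⌊b.repr (g *ᵥ x) y⌋ : ℝ) • (y : ι → ℝ) := by
    have : ic (∑ y, ⌊b.repr (g *ᵥ x) y⌋ • zz y) = ∑ y, (⌊b.repr (g *ᵥ x) y⌋ : ℝ) • ic (zz y) := by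
      funext i
      simp [ic, Finset.sum_apply]
    rw [this, Matrix.mulVec_sum]
    apply Finset.sum_congr rfl
    intro y _
    rw [mulVec_smul, ← hzz]
  rw [mulVec_sub, hic]
  have hx : g *ᵥ x = ∑ y, b.repr (g *ᵥ x) y • (y : ι → ℝ) := by
    conv_lhs => rw [← b.sum_repr (g *ᵥ x)]
    simp [b]
  have hx2 : g *ᵥ x - ∑ y, (⌊b.repr (g *ᵥ x) y⌋ : ℝ) • (y : ι → ℝ) =
      ∑ y, (b.repr (g *ᵥ x) y • (y : ι → ℝ) - (⌊b.repr (g *ᵥ x) y⌋ : ℝ) • (y : ι → ℝ)) := by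
    rw [Finset.sum_sub_distrib, ← hx]
  rw [hx2]
  refine le_trans (norm_sum_le _ _) (le_trans ?_ (le_max_right _ _))
  calc ∑ y, ‖b.repr (g *ᵥ x) y • (y : ι → ℝ) - (⌊b.repr (g *ᵥ x) y⌋ : ℝ) • (y : ι → ℝ)‖
      ≤ ∑ y : Y, M := by
        apply Finset.sum_le_sum
        intro y _
        rw [← sub_smul, norm_smul, Real.norm_eq_abs, Int.self_sub_floor, abs_of_nonneg (Int.fract_nonneg _)]
        have := hzn y
        have h1 := (Int.fract_lt_one (b.repr (g *ᵥ x) y)).le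
        have h0 := Int.fract_nonneg (b.repr (g *ᵥ x) y)
        nlinarith [norm_nonneg (y : ι → ℝ)]
    _ = d * M := by simp [hcard, hd]

/-- A Cantor-type construction with uniform branching has large Hausdorff dimension. -/
lemma cantor_dim {E : Type*} [NormedAddCommGroup E] [CompleteSpace E]
    (P : ℕ → E → Prop) (Rel : ℕ → E → E → Prop) (N : ℕ) (hN : 2 ≤ N) (L K s : ℝ)
    (hL : 2 ≤ L) (hK : 0 ≤ K) (hs : 0 < s) (hsK : 8 * K * L⁻¹ ≤ s) (a0 : E) (h0 : P 0 a0)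
    (hstep : ∀ k a, P k a → ∃ f : Fin N → E, (∀ i, P (k + 1) (f i) ∧ Rel k a (f i) ∧
      ‖f i - a‖ ≤ K * L⁻¹ ^ k) ∧ ∀ i j, i ≠ j → s * L⁻¹ ^ k ≤ ‖f i - f j‖) :
    ENNReal.ofReal (Real.log N / Real.log L) ≤
      dimH {A : E | ∃ a : ℕ → E, a 0 = a0 ∧ ∀ k, P k (a k) ∧ Rel k (a k) (a (k + 1)) ∧
        ‖A - a k‖ ≤ 2 * K * L⁻¹ ^ k} := by
  classical
  set q : ℝ := L⁻¹ with hq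
  have hL0 : 0 < L := by linarith
  have hq0 : 0 < q := by positivity
  have hq2 : q ≤ 1 / 2 := by
    rw [hq, one_div]; exact inv_anti₀ (by norm_num) hL
  have hch : ∀ k a, ∃ f : Fin N → E, P k a → ((∀ i, P (k + 1) (f i) ∧ Rel k a (f i) ∧
      ‖f i - a‖ ≤ K * q ^ k) ∧ ∀ i j, i ≠ j → s * q ^ k ≤ ‖f i - f j‖) := by
    intro k a
    by_cases h : P k a
    · obtain ⟨f, hf⟩ := hstep k a h
      exact ⟨f, fun _ => hf⟩
    · exact ⟨fun _ => a, fun h' => absurd h' h⟩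
  choose F hF using hch
  let a : (ℕ → Fin N) → ℕ → E := fun ω k => Nat.rec a0 (fun k x => F k x (ω k)) k
  have ha0 : ∀ ω, a ω 0 = a0 := fun ω => rfl
  have has : ∀ ω k, a ω (k + 1) = F k (a ω k) (ω k) := fun ω k => rfl
  have hP : ∀ ω k, P k (a ω k) := by
    intro ω k
    induction k with
    | zero => exact h0
    | succ k ih => rw [has]; exact ((hF k _ ih).1 _).1
  have hd : ∀ ω k, dist (a ω k) (a ω (k + 1)) ≤ K * q ^ k := by
    intro ω k
    rw [dist_comm, dist_eq_norm, has]
    exact ((hF k _ (hP ω k)).1 _).2.2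
  have hq1 : q < 1 := by linarith
  have hlim : ∀ ω, ∃ x, Tendsto (a ω) atTop (𝓝 x) := fun ω =>
    cauchySeq_tendsto_of_complete (cauchySeq_of_le_geometric q K hq1 (hd ω))
  choose π hπ using hlim
  have hπd : ∀ ω k, ‖π ω - a ω k‖ ≤ 2 * K * q ^ k := by
    intro ω k
    have h := dist_le_of_le_geometric_of_tendsto q K hq1 (hd ω) (hπ ω) k
    rw [dist_comm, dist_eq_norm] at h
    refine h.trans ?_
    rw [div_le_iff₀ (by linarith)]
    have : 0 ≤ K * q ^ k := by positivity
    nlinarith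
  have hcongr : ∀ ω ω' k, (∀ i < k, ω i = ω' i) → a ω k = a ω' k := by
    intro ω ω' k
    induction k with
    | zero => intro _; rfl
    | succ k ih =>
      intro h
      rw [has, has, ih (fun i hi => h i (by omega)), h k (by omega)]
  have hsep : ∀ ω ω' k, (∀ i < k, ω i = ω' i) → ω k ≠ ω' k → s / 2 * q ^ k ≤ ‖π ω - π ω'‖ := by
    intro ω ω' k h hne
    have h1 := (hF k _ (hP ω k)).2 _ _ hne
    rw [← has] at h1
    rw [hcongr ω ω' k h, ← has] at h1
    have h2 := hπd ω (k + 1)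
    have h3 := hπd ω' (k + 1)
    have h4 : ‖a ω (k + 1) - a ω' (k + 1)‖ ≤
        ‖π ω - π ω'‖ + ‖π ω - a ω (k + 1)‖ + ‖π ω' - a ω' (k + 1)‖ := by
      have : a ω (k + 1) - a ω' (k + 1) =
        (π ω - π ω') - (π ω - a ω (k + 1)) + (π ω' - a ω' (k + 1)) := by abel
      rw [this]
      exact (norm_add_le _ _).trans (by gcongr; exact norm_sub_le _ _)
    have h5 : 8 * K * q * q ^ k ≤ s * q ^ k := by gcongr
    rw [pow_succ] at h2 h3
    linarith
  have hfirst : ∀ ω ω' : ℕ → Fin N, ω ≠ ω' → ∃ k, (∀ i < k, ω i = ω' i) ∧ ω k ≠ ω' k := by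
    intro ω ω' h
    have hex : ∃ k, ω k ≠ ω' k := by
      by_contra hcon
      push Not at hcon
      exact h (funext hcon)
    refine ⟨Nat.find hex, fun i hi => ?_, Nat.find_spec hex⟩
    have := Nat.find_min hex hi
    simpa using this
  have hinj : Function.Injective π := by
    intro ω ω' h
    by_contra hne
    obtain ⟨k, hk1, hk2⟩ := hfirst ω ω' hne
    have := hsep ω ω' k hk1 hk2
    rw [h, sub_self, norm_zero] at this
    have h' : 0 < s / 2 * q ^ k := by positivity
    linarith
  have hlogL : 0 < Real.log L := Real.log_pos (by linarith)
  have hlogN : 0 < Real.log N := Real.log_pos (by exact_mod_cast (by omega : 1 < N))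
  set r : ℝ := Real.log N / Real.log L with hr
  have hr0 : 0 < r := by positivity
  have hqr : ∀ k : ℕ, (q ^ k) ^ r = ((N : ℝ) ^ k)⁻¹ := by
    intro k
    have hN0 : (0 : ℝ) < N := by positivity
    have : q ^ r = (N : ℝ)⁻¹ := by
      rw [hq, Real.inv_rpow hL0.le, Real.rpow_def_of_pos hL0, hr]
      rw [mul_div_cancel₀ _ hlogL.ne', Real.exp_log hN0]
    rw [← Real.rpow_natCast, ← Real.rpow_mul hq0.le, mul_comm, Real.rpow_mul hq0.le, this,
      Real.rpow_natCast, inv_pow]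
  have : NeZero N := ⟨by omega⟩
  have : Nonempty (ℕ → Fin N) := ⟨fun _ => 0⟩
  let φ : E → ℝ := fun x => Real.ofDigits (Function.invFun π x)
  have hφ : ∀ ω, φ (π ω) = Real.ofDigits ω := by
    intro ω
    simp only [φ]
    rw [Function.leftInverse_invFun hinj ω]
  have hcpos : 0 < (2 / s) ^ r := by positivity
  have hhol : HolderOnWith (NNReal.mk ((2 / s) ^ r) hcpos.le) (NNReal.mk r hr0.le) φ (Set.range π) := by
    rintro _ ⟨ω, rfl⟩ _ ⟨ω', rfl⟩
    rw [hφ, hφ]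
    by_cases hne : ω = ω'
    · subst hne; simp
    obtain ⟨k, hk1, hk2⟩ := hfirst ω ω' hne
    have h1 := Real.abs_ofDigits_sub_ofDigits_le hk1
    have h2 := hsep ω ω' k hk1 hk2
    have h3 : |Real.ofDigits ω - Real.ofDigits ω'| ≤ (2 / s) ^ r * ‖π ω - π ω'‖ ^ r := by
      refine h1.trans ?_
      rw [← hqr k, ← Real.mul_rpow (by positivity) (norm_nonneg _)]
      apply Real.rpow_le_rpow (by positivity) _ hr0.le
      rw [div_mul_eq_mul_div, le_div_iff₀ hs]
      linarith
    rw [edist_dist, edist_dist, Real.dist_eq, dist_eq_norm]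
    calc ENNReal.ofReal |Real.ofDigits ω - Real.ofDigits ω'|
        ≤ ENNReal.ofReal ((2 / s) ^ r * ‖π ω - π ω'‖ ^ r) := ENNReal.ofReal_le_ofReal h3
      _ = _ := by
        rw [ENNReal.ofReal_mul hcpos.le, ← ENNReal.ofReal_rpow_of_nonneg (norm_nonneg _) hr0.le]
        congr 1
        exact ENNReal.ofReal_eq_coe_nnreal hcpos.le
  have himg : Set.Icc (0 : ℝ) 1 ⊆ φ '' Set.range π := by
    intro y hy
    obtain ⟨ω, -, hω⟩ := Real.ofDigits_SurjOn (b := N) (by omega) hy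
    exact ⟨π ω, ⟨ω, rfl⟩, by rw [hφ, hω]⟩
  have h1 : (1 : ℝ≥0∞) ≤ dimH (φ '' Set.range π) := by
    have := Real.dimH_of_nonempty_interior (E := ℝ) (s := Set.Icc (0 : ℝ) 1) (by
      rw [interior_Icc]; exact ⟨1/2, by norm_num, by norm_num⟩)
    calc (1 : ℝ≥0∞) = dimH (Set.Icc (0 : ℝ) 1) := by rw [this]; simp
      _ ≤ _ := dimH_mono himg
  have h2 := h1.trans (hhol.dimH_image_le (show (0 : NNReal) < NNReal.mk r hr0.le from hr0))
  have h3 : ENNReal.ofReal r ≤ dimH (Set.range π) := by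
    rw [ENNReal.ofReal_eq_coe_nnreal hr0.le]
    rw [ENNReal.le_div_iff_mul_le] at h2
    · simpa using h2
    · left
      rw [Ne, ENNReal.coe_eq_zero]
      intro h
      exact hr0.ne' (congrArg NNReal.toReal h)
    · left; exact ENNReal.coe_ne_top
  refine h3.trans (dimH_mono ?_)
  rintro _ ⟨ω, rfl⟩
  refine ⟨a ω, ha0 ω, fun k => ⟨hP ω k, ?_, hπd ω k⟩⟩
  rw [has]
  exact ((hF k _ (hP ω k)).1 _).2.1

lemma vol_closedBall_mat {m n : ℕ} (x : Fin m → Fin n → ℝ) {s : ℝ} (hs : 0 ≤ s) :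
    volume (Metric.closedBall x s) = ENNReal.ofReal ((2 * s) ^ (n * m)) := by
  rw [volume_pi_closedBall _ hs]
  simp only [Real.volume_pi_closedBall _ hs]
  simp only [Finset.prod_const, Finset.card_univ, Fintype.card_fin]
  rw [← ENNReal.ofReal_pow (by positivity), ← pow_mul]

/-- A set of large volume contains many separated points. -/
lemma exists_separated {m n : ℕ} (G : Set (Fin m → Fin n → ℝ)) (s : ℝ) (hs : 0 ≤ s) (k : ℕ)
    (h : (k : ℝ≥0∞) * ENNReal.ofReal ((2 * s) ^ (n * m)) < volume G) :
    ∃ f : Fin (k + 1) → (Fin m → Fin n → ℝ), (∀ i, f i ∈ G) ∧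
      ∀ i j, i ≠ j → s ≤ ‖f i - f j‖ := by
  induction k with
  | zero =>
    have : G.Nonempty := by
      rw [Set.nonempty_iff_ne_empty]
      rintro rfl
      simp at h
    obtain ⟨x, hx⟩ := this
    exact ⟨fun _ => x, fun _ => hx, fun i j hij => absurd (Fin.ext (by omega)) hij⟩
  | succ k ih =>
    obtain ⟨f, hf, hsep⟩ := ih (lt_of_le_of_lt (by gcongr; simp) h)
    have hU : volume (⋃ i, Metric.closedBall (f i) s) < volume G := by
      refine lt_of_le_of_lt ?_ h
      refine (measure_iUnion_le _).trans ?_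
      rw [tsum_fintype]
      simp only [vol_closedBall_mat _ hs]
      simp
    obtain ⟨x, hxG, hxU⟩ : ∃ x ∈ G, x ∉ ⋃ i, Metric.closedBall (f i) s := by
      by_contra hcon
      push Not at hcon
      exact absurd (measure_mono (μ := volume) (show G ⊆ _ from hcon)) (not_le.mpr hU)
    have hx : ∀ i, s ≤ ‖x - f i‖ := by
      intro i
      have : x ∉ Metric.closedBall (f i) s := fun h => hxU (Set.mem_iUnion.mpr ⟨i, h⟩)
      rw [Metric.mem_closedBall, dist_eq_norm] at this
      linarith
    refine ⟨Fin.cons x f, ?_, ?_⟩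
    · intro i
      refine Fin.cases ?_ ?_ i
      · simpa using hxG
      · intro j; simpa using hf j
    · intro i j
      refine Fin.cases ?_ ?_ i
      · refine Fin.cases ?_ ?_ j
        · intro h; exact absurd rfl h
        · intro j _; simpa using hx j
      · intro i
        refine Fin.cases ?_ ?_ j
        · intro _
          rw [norm_sub_rev]
          simpa using hx i
        · intro j hij
          simpa using hsep i j (fun h => hij (by rw [h]))

/-- Row lemma. -/
lemma row_volume {n : ℕ} (wt : Fin n → ℝ) (hwt : ∀ j, 0 < wt j) (y : Fin n → ℝ) (x ε ψ : ℝ)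
    (hε : 0 < ε) (hψ : 0 < ψ) (hψj : ∃ j, wt j * |y j| = ψ) :
    volume {c : Fin n → ℝ | (∀ j, c j ∈ Set.Icc (wt j / 2) (wt j)) ∧
      |x + ∑ j, c j * y j| < ε} ≤ ENNReal.ofReal (4 * ε / ψ * ∏ j, (wt j / 2)) := by
  classical
  obtain ⟨j0, hj0⟩ := hψj
  have hy0 : y j0 ≠ 0 := by
    intro h; rw [h] at hj0; simp at hj0; linarith
  have habs : 0 < |y j0| := abs_pos.mpr hy0
  let M : Matrix (Fin n) (Fin n) ℝ := (1 : Matrix (Fin n) (Fin n) ℝ).updateRow j0 y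
  have hM : M.det = y j0 := det_updateRow_one' _ _
  have hdet : LinearMap.det (Matrix.toLin' M) ≠ 0 := by rwa [LinearMap.det_toLin', hM]
  let K : Set (Fin n → ℝ) := Set.Icc (fun j => if j = j0 then -x - ε else wt j / 2)
    (fun j => if j = j0 then -x + ε else wt j)
  have hsub : {c : Fin n → ℝ | (∀ j, c j ∈ Set.Icc (wt j / 2) (wt j)) ∧
      |x + ∑ j, c j * y j| < ε} ⊆ (Matrix.toLin' M) ⁻¹' K := by
    rintro c ⟨hc, hx⟩
    rw [abs_lt] at hx
    simp only [Set.mem_preimage, K, Set.mem_Icc, Matrix.toLin'_apply, M]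
    have hs : ∑ j, y j * c j = ∑ j, c j * y j := Finset.sum_congr rfl fun j _ => mul_comm _ _
    constructor <;> intro j <;> by_cases hj : j = j0
    · subst hj; rw [updateRow_one_mulVec_same, hs]; simp only [if_true]; linarith
    · rw [updateRow_one_mulVec_ne hj]; simp only [if_neg hj]; exact (hc j).1
    · subst hj; rw [updateRow_one_mulVec_same, hs]; simp only [if_true]; linarith
    · rw [updateRow_one_mulVec_ne hj]; simp only [if_neg hj]; exact (hc j).2
  refine (measure_mono hsub).trans ?_
  rw [Measure.addHaar_preimage_linearMap (volume : Measure (Fin n → ℝ)) hdet K,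
    LinearMap.det_toLin', hM, Real.volume_Icc_pi, ← ENNReal.ofReal_prod_of_nonneg,
    ← ENNReal.ofReal_mul (abs_nonneg _)]
  · apply ENNReal.ofReal_le_ofReal
    rw [← Finset.mul_prod_erase _ _ (Finset.mem_univ j0),
      ← Finset.mul_prod_erase _ (fun j => wt j / 2) (Finset.mem_univ j0)]
    have : ∏ j ∈ Finset.univ.erase j0, ((if j = j0 then -x + ε else wt j) -
        (if j = j0 then -x - ε else wt j / 2)) = ∏ j ∈ Finset.univ.erase j0, (wt j / 2) := by
      apply Finset.prod_congr rfl
      intro j hj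
      have := Finset.ne_of_mem_erase hj
      simp only [if_neg this]; ring
    rw [this, if_pos rfl, if_pos rfl, abs_inv, ← hj0]
    have hw := hwt j0
    apply le_of_eq
    field_simp
    ring
  · intro j _
    split_ifs
    · linarith
    · linarith [hwt j]

/-- A sublattice lemma: vectors off a fixed axis vector are bounded away from the axis. -/
lemma off_axis {ι : Type*} [Fintype ι] [DecidableEq ι] (ρ S : ℝ) (hρ : 0 < ρ) (hS : 0 < S) :
    ∃ c0 : ℝ, 0 < c0 ∧ c0 ≤ 1 ∧ ∀ (g : Matrix ι ι ℝ) (i0 : ι) (z0 : ι → ℤ) (β : ℝ),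
      g *ᵥ ic z0 = Pi.single i0 β → |β| ≤ S →
      (∀ z : ι → ℤ, z ≠ 0 → ρ ≤ ‖g *ᵥ ic z‖) → g.det = 1 → β ≠ 0 →
      ∀ z : ι → ℤ, (¬ ∃ c : ℝ, ic z = c • ic z0) → ∃ i, i ≠ i0 ∧ c0 ≤ |(g *ᵥ ic z) i| := by
  obtain ⟨Q, hQ⟩ := exists_nat_gt (2 * S / ρ)
  have hQ0 : (0 : ℝ) < Q := lt_of_le_of_lt (by positivity) hQ
  have hQn : 0 < Q := by exact_mod_cast hQ0
  refine ⟨min 1 (ρ / (2 * Q)), by positivity, min_le_left _ _, ?_⟩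
  intro g i0 z0 β hz0 hβ hlam hg hβ0 z hz
  by_contra hcon
  push Not at hcon
  obtain ⟨j, k, hk0, hkQ, hjk⟩ := Real.exists_int_int_abs_mul_sub_le ((g *ᵥ ic z) i0 / β) hQn
  have hne : k • z - j • z0 ≠ 0 := by
    intro h
    apply hz
    have h1 : ic (k • z - j • z0) = 0 := by rw [h]; funext i; simp [ic]
    rw [ic_sub, ic_smul, ic_smul, sub_eq_zero] at h1
    refine ⟨(j : ℝ) / k, ?_⟩
    have hk : (k : ℝ) ≠ 0 := by exact_mod_cast hk0.ne'
    rw [div_eq_inv_mul, mul_smul, ← h1, smul_smul, inv_mul_cancel₀ hk, one_smul]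
  have hb := hlam _ hne
  have hlt : ‖g *ᵥ ic (k • z - j • z0)‖ < ρ := by
    rw [pi_norm_lt_iff hρ]
    intro i
    rw [ic_sub, ic_smul, ic_smul, mulVec_sub, mulVec_smul, mulVec_smul, hz0, Real.norm_eq_abs]
    simp only [Pi.sub_apply, Pi.smul_apply, smul_eq_mul]
    have hkp : (0 : ℝ) < k := by exact_mod_cast hk0
    have hkQ' : (k : ℝ) ≤ Q := by exact_mod_cast hkQ
    by_cases hi : i = i0
    · subst hi
      rw [Pi.single_eq_same]
      have : (k : ℝ) * (g *ᵥ ic z) i - j * β = (k * ((g *ᵥ ic z) i / β) - j) * β := by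
        field_simp
      rw [mul_comm] at hjk
      rw [this, abs_mul]
      rw [mul_comm] at hjk
      calc _ ≤ 1 / ((Q : ℝ) + 1) * S := by gcongr
        _ < ρ := by
          rw [div_mul_eq_mul_div, div_lt_iff₀ (by positivity)]
          rw [div_lt_iff₀ hρ] at hQ
          nlinarith
    · rw [Pi.single_eq_of_ne hi, mul_zero, sub_zero, abs_mul, abs_of_pos hkp]
      have h1 := hcon i hi
      have h2 := lt_of_lt_of_le h1 (min_le_right _ _)
      calc (k : ℝ) * |(g *ᵥ ic z) i| ≤ Q * (ρ / (2 * Q)) := by gcongr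
        _ = ρ / 2 := by field_simp
        _ < ρ := by linarith
  linarith

/-- The upper part of the vector `u_B u`. -/
def up {m n : ℕ} (B : Fin m → Fin n → ℝ) (u : Fin m ⊕ Fin n → ℝ) (i : Fin m) : ℝ :=
  u (Sum.inl i) + ∑ j, B i j * u (Sum.inr j)

lemma abs_sum_wt_le {n : ℕ} (wt c y : Fin n → ℝ) (hwt : ∀ j, 0 < wt j)
    (hc : ∀ j, c j ∈ Set.Icc (wt j / 2) (wt j)) :
    |∑ j, c j * y j| ≤ n * ‖fun j => wt j * y j‖ := by
  calc |∑ j, c j * y j| ≤ ∑ j, |c j * y j| := Finset.abs_sum_le_sum_abs _ _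
    _ ≤ ∑ j : Fin n, ‖fun j => wt j * y j‖ := by
      apply Finset.sum_le_sum
      intro j _
      refine le_trans ?_ (norm_le_pi_norm (fun j => wt j * y j) j)
      rw [Real.norm_eq_abs, abs_mul, abs_mul]
      have h1 := (hc j).1
      have h2 := (hc j).2
      have := hwt j
      rw [abs_of_pos (hwt j), abs_of_nonneg (by linarith)]
      gcongr
    _ = _ := by simp

/-- First comparison function integral. -/
lemma G1_integral {m n : ℕ} (wt : Fin n → ℝ) (ε Y c : ℝ) (hε : 0 < ε)
    (hY : 0 < Y) (hc : 0 < c) :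
    ∃ G : (Fin m ⊕ Fin n → ℝ) → ℝ≥0∞, Measurable G ∧
      (∀ u : Fin m ⊕ Fin n → ℝ, (∀ i, |u (Sum.inl i)| ≤ c * ‖fun j => wt j * u (Sum.inr j)‖) →
        (∀ j, |u (Sum.inr j)| ≤ 2 * Y) →
        ENNReal.ofReal ((8 * ε / ‖fun j => wt j * u (Sum.inr j)‖) ^ m) ≤ G u) ∧
      ∫⁻ u, G u ≤ ENNReal.ofReal ((16 * c) ^ m * ε ^ m * (4 * Y) ^ n) := by
  classical
  let ψ : (Fin n → ℝ) → ℝ := fun y => ‖fun j => wt j * y j‖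
  have hψc : Continuous ψ := by
    apply Continuous.norm
    apply continuous_pi
    intro j
    fun_prop
  let A : Set ((Fin m → ℝ) × (Fin n → ℝ)) :=
    {p | (∀ i, |p.1 i| ≤ c * ψ p.2) ∧ ∀ j, |p.2 j| ≤ 2 * Y}
  have hA : MeasurableSet A := by
    apply IsClosed.measurableSet
    have hAeq : A = (⋂ i, {p | |p.1 i| ≤ c * ψ p.2}) ∩ ⋂ j, {p | |p.2 j| ≤ 2 * Y} := by
      ext p
      simp [A]
    rw [hAeq]
    apply IsClosed.inter
    · apply isClosed_iInter
      intro i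
      apply isClosed_le <;> fun_prop
    · apply isClosed_iInter
      intro j
      apply isClosed_le <;> fun_prop
  let H : (Fin m → ℝ) × (Fin n → ℝ) → ℝ≥0∞ :=
    A.indicator (fun p => ENNReal.ofReal ((8 * ε / ψ p.2) ^ m))
  have hψm : Measurable ψ := hψc.measurable
  have hH : Measurable H := by
    apply Measurable.indicator _ hA
    apply Measurable.ennreal_ofReal
    apply Measurable.pow_const
    exact measurable_const.div (hψm.comp measurable_snd)
  let e := MeasurableEquiv.sumPiEquivProdPi (fun _ : Fin m ⊕ Fin n => ℝ)
  have he : MeasurePreserving e := volume_measurePreserving_sumPiEquivProdPi (fun _ => ℝ)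
  refine ⟨fun u => H (e u), hH.comp e.measurable, ?_, ?_⟩
  · intro u hu1 hu2
    have hmem : e u ∈ A := ⟨hu1, hu2⟩
    simp only [H]
    rw [Set.indicator_of_mem hmem]
    exact le_rfl
  · rw [he.lintegral_comp hH, Measure.volume_eq_prod, lintegral_prod_symm' _ hH]
    have hin : ∀ y : Fin n → ℝ, ∫⁻ x, H (x, y) ≤
        (Set.Icc (fun _ => -(2 * Y)) (fun _ => 2 * Y) : Set (Fin n → ℝ)).indicator
          (fun _ => ENNReal.ofReal ((16 * c) ^ m * ε ^ m)) y := by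
      intro y
      by_cases hy : ∀ j, |y j| ≤ 2 * Y
      · have hy' : y ∈ (Set.Icc (fun _ => -(2 * Y)) (fun _ => 2 * Y) : Set (Fin n → ℝ)) :=
          ⟨fun j => (abs_le.mp (hy j)).1, fun j => (abs_le.mp (hy j)).2⟩
        rw [Set.indicator_of_mem hy']
        have hψ0 : 0 ≤ ψ y := norm_nonneg _
        have : ∀ x, H (x, y) ≤ (Set.Icc (fun _ => -(c * ψ y)) (fun _ => c * ψ y) :
            Set (Fin m → ℝ)).indicator (fun _ => ENNReal.ofReal ((8 * ε / ψ y) ^ m)) x := by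
          intro x
          by_cases hx : (x, y) ∈ A
          · simp only [H]
            rw [Set.indicator_of_mem hx, Set.indicator_of_mem]
            exact ⟨fun j => (abs_le.mp (hx.1 j)).1, fun j => (abs_le.mp (hx.1 j)).2⟩
          · simp only [H]
            rw [Set.indicator_of_notMem hx]
            exact zero_le
        refine (lintegral_mono this).trans ?_
        rw [lintegral_indicator_const measurableSet_Icc, Real.volume_Icc_pi]
        simp only [Finset.prod_const, Finset.card_univ, Fintype.card_fin]
        rw [← ENNReal.ofReal_pow (by nlinarith), ← ENNReal.ofReal_mul (by positivity)]
        apply ENNReal.ofReal_le_ofReal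
        rw [← mul_pow, ← mul_pow]
        have : 8 * ε / ψ y * (c * ψ y - -(c * ψ y)) ≤ 16 * c * ε := by
          rcases hψ0.eq_or_lt with h | h
          · rw [← h]; simp; positivity
          · apply le_of_eq; field_simp; ring
        have h0 : 0 ≤ 8 * ε / ψ y * (c * ψ y - -(c * ψ y)) := by
          have : 0 ≤ c * ψ y := by positivity
          apply mul_nonneg (by positivity); linarith
        exact pow_le_pow_left₀ h0 this m
      · have : ∀ x, H (x, y) = 0 := by
          intro x
          simp only [H]
          rw [Set.indicator_of_notMem]
          intro h
          exact hy h.2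
        simp [this]
    refine (lintegral_mono hin).trans ?_
    rw [lintegral_indicator_const measurableSet_Icc, Real.volume_Icc_pi]
    simp only [Finset.prod_const, Finset.card_univ, Fintype.card_fin]
    rw [← ENNReal.ofReal_pow (by linarith), ← ENNReal.ofReal_mul (by positivity)]
    apply ENNReal.ofReal_le_ofReal
    apply le_of_eq
    ring

/-- Second comparison function integral. -/
lemma G2_integral {m n : ℕ} (wt : Fin n → ℝ) (hwt : ∀ j, 0 < wt j) (a K R : ℝ) (ha : 0 ≤ a)
    (hK : 0 < K) (hR : 0 < R) :
    ∃ G : (Fin m ⊕ Fin n → ℝ) → ℝ≥0∞, Measurable G ∧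
      (∀ u : Fin m ⊕ Fin n → ℝ, (∀ i, |u (Sum.inl i)| ≤ K) →
        (∀ j, wt j * |u (Sum.inr j)| ≤ R) → ENNReal.ofReal a ≤ G u) ∧
      ∫⁻ u, G u ≤ ENNReal.ofReal (a * ((2 * K) ^ m * ((2 * R) ^ n / ∏ j, wt j))) := by
  classical
  let b : Fin m ⊕ Fin n → ℝ := Sum.elim (fun _ => K) (fun j => R / wt j)
  have hb : ∀ i, 0 ≤ b i := by
    rintro (i | j)
    · exact hK.le
    · exact div_nonneg hR.le (hwt j).le
  refine ⟨(Set.Icc (-b) b).indicator (fun _ => ENNReal.ofReal a),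
    measurable_const.indicator measurableSet_Icc, ?_, ?_⟩
  · intro u h1 h2
    rw [Set.indicator_of_mem]
    have : ∀ i, |u i| ≤ b i := by
      rintro (i | j)
      · exact h1 i
      · simp only [b, Sum.elim_inr]
        rw [le_div_iff₀ (hwt j), mul_comm]
        exact h2 j
    exact ⟨fun i => (abs_le.mp (this i)).1, fun i => (abs_le.mp (this i)).2⟩
  · rw [lintegral_indicator_const measurableSet_Icc, Real.volume_Icc_pi,
      ← ENNReal.ofReal_prod_of_nonneg, ← ENNReal.ofReal_mul ha]
    · apply ENNReal.ofReal_le_ofReal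
      apply le_of_eq
      rw [Fintype.prod_sum_type]
      simp only [b, Pi.neg_apply, Sum.elim_inl, Sum.elim_inr, sub_neg_eq_add, ← two_mul,
        Finset.prod_const, Finset.card_univ, Fintype.card_fin, ← mul_div_assoc]
      rw [Finset.prod_div_distrib]
      simp
      ring
    · intro i _
      simp only [Pi.neg_apply]
      linarith [hb i]

/-- Core measure estimate, normalized, with explicit smallness hypotheses. -/
lemma core_norm {m n : ℕ} (hn : 0 < n) (D c1 ε τ Y : ℝ)
    (hD : 1 ≤ D) (hc1 : 0 < c1) (hc1' : c1 ≤ 1) (hε : 0 < ε) (hεc : ε ≤ c1) (hτ : 0 < τ)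
    (hτ1 : τ ≤ 1) (hYD : D ≤ Y)
    (h1 : (16 * (2 * ((n : ℝ) + 2))) ^ m * ε ^ m * (4 * Y) ^ n ≤ 1 / 4)
    (h2 : (4 * ε / c1) ^ m * ((2 * ((4 * n + 2) * D)) ^ m * (2 * (5 * D)) ^ n) ≤ τ / 4)
    (g : Matrix (Fin m ⊕ Fin n) (Fin m ⊕ Fin n) ℝ) (hg : g.det = 1)
    (hcov : ∀ x : Fin m ⊕ Fin n → ℝ, ∃ z : Fin m ⊕ Fin n → ℤ, ‖g *ᵥ (x - ic z)‖ ≤ D)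
    (j0 : Fin n) (z0 : Fin m ⊕ Fin n → ℤ)
    (hoff : ∀ z : Fin m ⊕ Fin n → ℤ, (¬ ∃ c : ℝ, ic z = c • ic z0) →
      ∃ i, i ≠ Sum.inr j0 ∧ 2 * n * c1 ≤ |(g *ᵥ ic z) i|)
    (wt : Fin n → ℝ) (hwt : ∀ j, wt j = if j = j0 then τ else 1) :
    volume {C : Fin m → Fin n → ℝ | (∀ i j, C i j ∈ Set.Icc (wt j / 2) (wt j)) ∧
      ∃ z : Fin m ⊕ Fin n → ℤ, (¬ ∃ c : ℝ, ic z = c • ic z0) ∧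
        (∀ i, |up C (g *ᵥ ic z) i| < ε) ∧ ∀ j, |(g *ᵥ ic z) (Sum.inr j)| ≤ Y} ≤
    ENNReal.ofReal ((∏ j, (wt j / 2)) ^ m / 2) := by
  classical
  have hn1 : (1 : ℝ) ≤ n := by exact_mod_cast hn
  have hwt0 : ∀ j, 0 < wt j := by
    intro j; rw [hwt]; split_ifs <;> linarith
  have hwt1 : ∀ j, wt j ≤ 1 := by
    intro j; rw [hwt]; split_ifs <;> linarith
  have hprod : ∏ j, wt j = τ := by
    rw [← Finset.mul_prod_erase _ _ (Finset.mem_univ j0)]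
    rw [Finset.prod_eq_one, hwt, if_pos rfl, mul_one]
    intro j hj
    rw [hwt, if_neg (Finset.ne_of_mem_erase hj)]
  set V : ℝ := (∏ j, (wt j / 2)) ^ m with hV
  have hVpos : 0 < V := by
    apply pow_pos
    apply Finset.prod_pos
    intro j _
    have := hwt0 j
    positivity
  obtain ⟨G1, hG1m, hG1, hG1i⟩ := G1_integral (m := m) wt ε Y (2 * ((n : ℝ) + 2)) hε
    (by linarith) (by positivity)
  obtain ⟨G2, hG2m, hG2, hG2i⟩ := G2_integral (m := m) wt hwt0 ((4 * ε / c1) ^ m)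
    ((4 * n + 2) * D) (5 * D) (by positivity) (by positivity) (by positivity)
  let Bz : (Fin m ⊕ Fin n → ℤ) → Set (Fin m → Fin n → ℝ) := fun z =>
    {C | (∀ i j, C i j ∈ Set.Icc (wt j / 2) (wt j)) ∧ (¬ ∃ c : ℝ, ic z = c • ic z0) ∧
        (∀ i, |up C (g *ᵥ ic z) i| < ε) ∧ ∀ j, |(g *ᵥ ic z) (Sum.inr j)| ≤ Y}
  have hsub : {C : Fin m → Fin n → ℝ | (∀ i j, C i j ∈ Set.Icc (wt j / 2) (wt j)) ∧
      ∃ z : Fin m ⊕ Fin n → ℤ, (¬ ∃ c : ℝ, ic z = c • ic z0) ∧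
        (∀ i, |up C (g *ᵥ ic z) i| < ε) ∧ ∀ j, |(g *ᵥ ic z) (Sum.inr j)| ≤ Y} ⊆ ⋃ z, Bz z := by
    rintro C ⟨hC, z, h⟩
    exact Set.mem_iUnion.mpr ⟨z, hC, h⟩
  refine (measure_mono hsub).trans ((measure_iUnion_le _).trans ?_)
  refine (sum_le_lintegral g hg D hcov _ (fun u => ENNReal.ofReal V * (G1 u + G2 u))
    ((hG1m.add hG2m).const_mul _) ?_).trans ?_
  · intro z δ hδ
    by_cases hne : (Bz z).Nonempty
    swap
    · rw [Set.not_nonempty_iff_eq_empty.mp hne]; simp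
    obtain ⟨C, hC, hline, hup, hyY⟩ := hne
    set u := g *ᵥ ic z with hu
    set ψ := ‖fun j => wt j * u (Sum.inr j)‖ with hψ
    have hψle : ∀ j, wt j * |u (Sum.inr j)| ≤ ψ := by
      intro j
      have := norm_le_pi_norm (fun j => wt j * u (Sum.inr j)) j
      rw [Real.norm_eq_abs, abs_mul, abs_of_pos (hwt0 j)] at this
      exact this
    have hx : ∀ i, |u (Sum.inl i)| ≤ n * ψ + ε := by
      intro i
      have ha := abs_sum_wt_le wt (C i) (fun j => u (Sum.inr j)) hwt0 (hC i)
      have hb := hup i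
      have : u (Sum.inl i) = up C u i - ∑ j, C i j * u (Sum.inr j) := by simp [up]
      rw [this]
      refine (abs_sub _ _).trans ?_
      linarith
    have hψc : c1 ≤ ψ := by
      obtain ⟨i, hi, hci⟩ := hoff z hline
      rcases i with i | j
      · have h3 := hx i
        have h4 : 2 * n * c1 ≤ n * ψ + c1 := by linarith
        by_contra hcon
        push Not at hcon
        nlinarith
      · have hj : j ≠ j0 := fun h => hi (by rw [h])
        have := hψle j
        rw [hwt, if_neg hj] at this
        nlinarith
    have hψ0 : 0 < ψ := by linarith
    have hex : ∃ j, wt j * |u (Sum.inr j)| = ψ := by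
      have : Nonempty (Fin n) := ⟨j0⟩
      obtain ⟨j, -, hj⟩ := Finset.exists_max_image Finset.univ (fun j => wt j * |u (Sum.inr j)|)
        Finset.univ_nonempty
      refine ⟨j, le_antisymm (hψle j) ?_⟩
      rw [hψ, pi_norm_le_iff_of_nonneg (mul_nonneg (hwt0 j).le (abs_nonneg _))]
      intro k
      rw [Real.norm_eq_abs, abs_mul, abs_of_pos (hwt0 k)]
      exact hj k (Finset.mem_univ _)
    have hvol : volume (Bz z) ≤ ENNReal.ofReal ((4 * ε / ψ) ^ m * V) := by
      have hs : Bz z ⊆ Set.pi Set.univ (fun i : Fin m => {c : Fin n → ℝ |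
          (∀ j, c j ∈ Set.Icc (wt j / 2) (wt j)) ∧
            |u (Sum.inl i) + ∑ j, c j * u (Sum.inr j)| < ε}) := by
        rintro C ⟨h1, -, h2, -⟩ i -
        exact ⟨h1 i, h2 i⟩
      refine (measure_mono hs).trans ?_
      rw [volume_pi_pi]
      refine (Finset.prod_le_prod' (fun i _ => row_volume wt hwt0 (fun j => u (Sum.inr j))
        (u (Sum.inl i)) ε ψ hε hψ0 hex)).trans ?_
      simp only [Finset.prod_const, Finset.card_univ, Fintype.card_fin]
      rw [← ENNReal.ofReal_pow, mul_pow]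
      apply mul_nonneg (by positivity)
      apply Finset.prod_nonneg
      intro j _
      linarith [hwt0 j]
    refine hvol.trans ?_
    rw [mul_comm ((4 * ε / ψ) ^ m) V, ENNReal.ofReal_mul hVpos.le]
    gcongr
    have hδi : ∀ i, |δ i| ≤ D := fun i => (norm_le_pi_norm δ i).trans hδ
    have hx' : ∀ i, |(u + δ) (Sum.inl i)| ≤ n * ψ + ε + D := by
      intro i
      exact (abs_add_le _ _).trans (by linarith [hx i, hδi (Sum.inl i)])
    have hwδ : ∀ j, wt j * |δ (Sum.inr j)| ≤ D := by
      intro j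
      have := hδi (Sum.inr j)
      nlinarith [hwt0 j, hwt1 j, abs_nonneg (δ (Sum.inr j))]
    have hy' : ∀ j, wt j * |(u + δ) (Sum.inr j)| ≤ ψ + D := by
      intro j
      have h3 : |(u + δ) (Sum.inr j)| ≤ |u (Sum.inr j)| + |δ (Sum.inr j)| := abs_add_le _ _
      have h4 := hψle j
      have h5 := hwδ j
      have := hwt0 j
      nlinarith
    set ψ' := ‖fun j => wt j * (u + δ) (Sum.inr j)‖ with hψ'
    by_cases hbig : 4 * D ≤ ψ
    · have hup' : ψ' ≤ ψ + D := by
        rw [hψ', pi_norm_le_iff_of_nonneg (by linarith)]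
        intro j
        rw [Real.norm_eq_abs, abs_mul, abs_of_pos (hwt0 j)]
        exact hy' j
      have hlow : ψ - D ≤ ψ' := by
        obtain ⟨j, hj⟩ := hex
        have h3 := norm_le_pi_norm (fun j => wt j * (u + δ) (Sum.inr j)) j
        rw [Real.norm_eq_abs, abs_mul, abs_of_pos (hwt0 j)] at h3
        have h4 : |u (Sum.inr j)| ≤ |(u + δ) (Sum.inr j)| + |δ (Sum.inr j)| := by
          have : u (Sum.inr j) = (u + δ) (Sum.inr j) - δ (Sum.inr j) := by simp
          rw [this]
          simpa using abs_sub ((u + δ) (Sum.inr j)) (δ (Sum.inr j))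
        have h5 := hwδ j
        have := hwt0 j
        nlinarith
      refine le_trans ?_ ((hG1 (u + δ) ?_ ?_).trans le_self_add)
      · apply ENNReal.ofReal_le_ofReal
        have hp' : 0 < ψ' := by linarith
        apply pow_le_pow_left₀ (by positivity)
        rw [div_le_div_iff₀ hψ0 hp']
        nlinarith
      · intro i
        refine (hx' i).trans ?_
        nlinarith
      · intro j
        exact (abs_add_le _ _).trans (by linarith [hyY j, hδi (Sum.inr j)])
    · push Not at hbig
      refine le_trans ?_ ((hG2 (u + δ) ?_ ?_).trans le_add_self)
      · apply ENNReal.ofReal_le_ofReal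
        apply pow_le_pow_left₀ (by positivity)
        gcongr
      · intro i
        refine (hx' i).trans ?_
        nlinarith
      · intro j
        linarith [hy' j]
  · rw [lintegral_const_mul _ (show Measurable fun u => G1 u + G2 u from hG1m.add hG2m),
      lintegral_add_left hG1m]
    calc _ ≤ ENNReal.ofReal V * (ENNReal.ofReal (1 / 4) + ENNReal.ofReal (1 / 4)) := by
          gcongr
          · exact hG1i.trans (ENNReal.ofReal_le_ofReal h1)
          · refine hG2i.trans (ENNReal.ofReal_le_ofReal ?_)
            rw [hprod, ← mul_div_assoc, ← mul_div_assoc, div_le_iff₀ hτ]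
            linarith
      _ = ENNReal.ofReal (V / 2) := by
          rw [← ENNReal.ofReal_add (by norm_num) (by norm_num), ← ENNReal.ofReal_mul hVpos.le]
          congr 1
          ring

/-- The block matrix `a_t u_B`. -/
def gm (m n : ℕ) (t : ℝ) (B : Fin m → Fin n → ℝ) : Matrix (Fin m ⊕ Fin n) (Fin m ⊕ Fin n) ℝ :=
  fromBlocks (Real.exp (t / m) • (1 : Matrix (Fin m) (Fin m) ℝ)) (Real.exp (t / m) • Matrix.of B) 0
    (Real.exp (-(t / n)) • (1 : Matrix (Fin n) (Fin n) ℝ))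

lemma gm_inl {m n : ℕ} (t : ℝ) (B : Fin m → Fin n → ℝ) (u : Fin m ⊕ Fin n → ℝ) (i : Fin m) :
    (gm m n t B *ᵥ u) (Sum.inl i) = Real.exp (t / m) * up B u i := by
  simp [gm, up, mulVec, dotProduct, Matrix.one_apply, Finset.mul_sum, mul_add,
    mul_assoc]

lemma gm_inr {m n : ℕ} (t : ℝ) (B : Fin m → Fin n → ℝ) (u : Fin m ⊕ Fin n → ℝ) (j : Fin n) :
    (gm m n t B *ᵥ u) (Sum.inr j) = Real.exp (-(t / n)) * u (Sum.inr j) := by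
  simp [gm, mulVec, dotProduct, Matrix.one_apply]

lemma exp_div_pow {m : ℕ} (hm : 0 < m) (t : ℝ) : Real.exp (t / m) ^ m = Real.exp t := by
  rw [← Real.exp_nat_mul]
  congr 1
  field_simp

lemma exp_neg_div_pow {m : ℕ} (hm : 0 < m) (t : ℝ) :
    Real.exp (-(t / m)) ^ m = Real.exp (-t) := by
  rw [← Real.exp_nat_mul]
  congr 1
  field_simp

lemma gm_det {m n : ℕ} (hm : 0 < m) (hn : 0 < n) (t : ℝ) (B : Fin m → Fin n → ℝ) :
    (gm m n t B).det = 1 := by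
  rw [gm, det_fromBlocks_zero₂₁, det_smul, det_smul]
  simp only [det_one, Fintype.card_fin, mul_one]
  rw [exp_div_pow hm, exp_neg_div_pow hn, ← Real.exp_add]
  simp

lemma gm_mul {m n : ℕ} (t T : ℝ) (A B : Fin m → Fin n → ℝ) :
    gm m n T B * gm m n t A = gm m n (t + T) (A + Real.exp (-(t * (1 / m + 1 / n))) • B) := by
  have e1 : Real.exp (T / m) * Real.exp (t / m) = Real.exp ((t + T) / m) := by
    rw [← Real.exp_add]; congr 1; ring
  have e2 : Real.exp (-(T / n)) * Real.exp (-(t / n)) = Real.exp (-((t + T) / n)) := by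
    rw [← Real.exp_add]; congr 1; ring
  have e3 : Real.exp (T / m) * Real.exp (-(t / n)) =
      Real.exp ((t + T) / m) * Real.exp (-(t * (1 / m + 1 / n))) := by
    rw [← Real.exp_add, ← Real.exp_add]; congr 1; ring
  rw [gm, gm, gm, fromBlocks_multiply]
  congr 1
  · simp [smul_smul, ← e1, mul_comm]
  · ext i j
    simp only [one_div] at e3
    simp [smul_smul]
    rw [mul_add, ← mul_assoc, ← e3, ← e1]
    ring
  · simp
  · simp [smul_smul, ← e2, mul_comm]

/-- Core measure estimate, normalized, for large times. -/
lemma core_norm_T {m n : ℕ} (hm : 2 ≤ m) (hn : 0 < n) (r' : ℝ) (hr' : 0 < r')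
    (hsmall : (16 * (2 * ((n : ℝ) + 2))) ^ m * 8 ^ n * r' ^ (m + n) ≤ 1 / 4)
    (ρ r0 S ν : ℝ) (hρ : 0 < ρ) (hr0 : 0 < r0) (hS : 0 < S) (hν : 0 < ν) :
    ∃ T0 : ℝ, ∀ T ≥ T0, ∀ g : Matrix (Fin m ⊕ Fin n) (Fin m ⊕ Fin n) ℝ, g.det = 1 →
      (∀ z : Fin m ⊕ Fin n → ℤ, z ≠ 0 → ρ ≤ ‖g *ᵥ ic z‖) →
      ∀ (z0 : Fin m ⊕ Fin n → ℤ) (β : ℝ) (j0 : Fin n), g *ᵥ ic z0 = Pi.single (Sum.inr j0) β →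
      r0 ≤ |β| → |β| ≤ S → ∀ wt : Fin n → ℝ,
      (∀ j, wt j = if j = j0 then ν * Real.exp (-(T / m)) / |β| else 1) →
      ν * Real.exp (-(T / m)) / |β| ≤ 1 ∧
      volume {C : Fin m → Fin n → ℝ | (∀ i j, C i j ∈ Set.Icc (wt j / 2) (wt j)) ∧
        ∃ z : Fin m ⊕ Fin n → ℤ, (¬ ∃ c : ℝ, ic z = c • ic z0) ∧
        (∀ i, |up C (g *ᵥ ic z) i| < r' * Real.exp (-(T / m))) ∧
          ∀ j, |(g *ᵥ ic z) (Sum.inr j)| ≤ 2 * r' * Real.exp (T / n)} ≤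
      ENNReal.ofReal ((∏ j, (wt j / 2)) ^ m / 2) := by
  have hm0 : 0 < m := by omega
  have : Nonempty (Fin m ⊕ Fin n) := ⟨Sum.inl ⟨0, hm0⟩⟩
  have hmR : (0 : ℝ) < m := by exact_mod_cast hm0
  have hnR : (0 : ℝ) < n := by exact_mod_cast hn
  have hnR1 : (1 : ℝ) ≤ n := by exact_mod_cast hn
  obtain ⟨D, hD1, hD⟩ := covering (ι := Fin m ⊕ Fin n) ρ hρ
  obtain ⟨c0, hc0, hc01, hoff⟩ := off_axis (ι := Fin m ⊕ Fin n) ρ S hρ hS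
  set c1 : ℝ := c0 / (2 * n) with hc1
  have hc1pos : 0 < c1 := by positivity
  have hc1le : c1 ≤ 1 := by
    rw [hc1, div_le_one (by positivity)]; linarith
  set A : ℝ := (4 * r' / c1) ^ m * ((2 * ((4 * n + 2) * D)) ^ m * (2 * (5 * D)) ^ n) with hA
  have hApos : 0 < A := by positivity
  have hlim : Tendsto (fun T : ℝ => Real.exp (-(T / m))) atTop (𝓝 0) := by
    apply Real.tendsto_exp_neg_atTop_nhds_zero.comp
    exact tendsto_id.atTop_div_const hmR
  have hlim2 : Tendsto (fun T : ℝ => Real.exp (T / n)) atTop atTop :=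
    Real.tendsto_exp_atTop.comp (tendsto_id.atTop_div_const hnR)
  have hev := ((hlim.eventually (gt_mem_nhds (show (0 : ℝ) < c1 / r' by positivity))).and
    ((hlim.eventually (gt_mem_nhds (show (0 : ℝ) < r0 / ν by positivity))).and
    ((hlim.eventually (gt_mem_nhds (show (0 : ℝ) < 1 by positivity))).and
    ((hlim.eventually (gt_mem_nhds (show (0 : ℝ) < ν / (4 * S * A) by positivity))).and
    (hlim2.eventually_ge_atTop (D / (2 * r')))))))
  obtain ⟨T0, hT0⟩ := eventually_atTop.mp hev
  refine ⟨T0, ?_⟩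
  intro T hT g hg hlam z0 β j0 hz0 hβ0 hβS wt hwt
  obtain ⟨e1, e2, e3, e4, e5⟩ := hT0 T hT
  set x : ℝ := Real.exp (-(T / m)) with hx
  have hx0 : 0 < x := Real.exp_pos _
  have hβpos : 0 < |β| := by linarith
  have hβne : β ≠ 0 := abs_pos.mp hβpos
  have hτ1 : ν * x / |β| ≤ 1 := by
    rw [div_le_one hβpos]
    rw [lt_div_iff₀ hν] at e2
    linarith
  refine ⟨hτ1, ?_⟩
  have hxm : x ^ m = Real.exp (-T) := exp_neg_div_pow hm0 T
  apply core_norm hn D c1 (r' * x) (ν * x / |β|) (2 * r' * Real.exp (T / n)) hD1 hc1pos hc1le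
    (by positivity) _ (by positivity) hτ1 _ _ _ g hg (hD g hg hlam) j0 z0 _ wt hwt
  · rw [lt_div_iff₀ hr'] at e1
    linarith
  · rw [div_le_iff₀ (by positivity)] at e5
    linarith
  · refine le_trans (le_of_eq ?_) hsmall
    have : (4 * (2 * r' * Real.exp (T / n))) ^ n = 8 ^ n * r' ^ n * Real.exp T := by
      rw [← exp_div_pow hn T, ← mul_pow, ← mul_pow]; congr 1; ring
    rw [this, mul_pow r' x, hxm, pow_add, Real.exp_neg]
    field_simp
  · have h3 : (4 * (r' * x) / c1) ^ m = (4 * r' / c1) ^ m * x ^ m := by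
      rw [← mul_pow]; congr 1; ring
    rw [h3, mul_assoc, mul_comm (x ^ m), ← mul_assoc, ← hA]
    have h4 : x ^ m ≤ x ^ 2 := pow_le_pow_of_le_one hx0.le e3.le hm
    have h5 : A * x ≤ ν / (4 * S) := by
      rw [lt_div_iff₀ (by positivity)] at e4
      rw [le_div_iff₀ (by positivity)]
      nlinarith
    calc A * x ^ m ≤ A * x ^ 2 := by gcongr
      _ = (A * x) * x := by ring
      _ ≤ ν / (4 * S) * x := by gcongr
      _ = ν * x / S / 4 := by field_simp
      _ ≤ ν * x / |β| / 4 := by gcongr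
  · intro z hz
    obtain ⟨i, hi, hi2⟩ := hoff g (Sum.inr j0) z0 β hz0 hβS hlam hg hβne z hz
    refine ⟨i, hi, le_trans (le_of_eq ?_) hi2⟩
    rw [hc1]; field_simp

lemma mulVec_updateCol_one {ι : Type*} [Fintype ι] [DecidableEq ι] (j : ι) (v u : ι → ℝ) (i : ι) :
    (((1 : Matrix ι ι ℝ).updateCol j v) *ᵥ u) i = v i * u j + (if i = j then 0 else u i) := by
  rw [mulVec, dotProduct, ← Finset.add_sum_erase _ _ (Finset.mem_univ j)]
  congr 1
  · simp
  · rw [Finset.sum_congr rfl (g := fun k => if i = k then u k else 0)]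
    · rw [Finset.sum_ite_eq]
      simp only [Finset.mem_erase, Finset.mem_univ, and_true]
      split_ifs <;> simp_all
    · intro k hk
      rw [updateCol_apply, if_neg (Finset.ne_of_mem_erase hk), Matrix.one_apply]
      split_ifs <;> simp

lemma det_updateCol_one {ι : Type*} [Fintype ι] [DecidableEq ι] (i : ι) (f : ι → ℝ) :
    ((1 : Matrix ι ι ℝ).updateCol i f).det = f i := by
  rw [← det_transpose, ← updateRow_transpose, transpose_one, det_updateRow_one']

set_option maxHeartbeats 1000000 in
/-- Core step: many separated good perturbations. -/
lemma core_step {m n : ℕ} (hm : 2 ≤ m) (hn : 0 < n) (r' : ℝ) (hr' : 0 < r')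
    (hsmall : (16 * (2 * ((n : ℝ) + 2))) ^ m * 8 ^ n * r' ^ (m + n) ≤ 1 / 4)
    (ρ r0 S ν s0 : ℝ) (hρ : 0 < ρ) (hr0 : 0 < r0) (hS : 0 < S) (hν : 0 < ν) (hs0 : 0 < s0) :
    ∃ c : ℝ, 0 < c ∧ ∃ T0 : ℝ, ∀ T ≥ T0,
      ∀ g : Matrix (Fin m ⊕ Fin n) (Fin m ⊕ Fin n) ℝ, g.det = 1 →
      (∀ z : Fin m ⊕ Fin n → ℤ, z ≠ 0 → ρ ≤ ‖g *ᵥ ic z‖) →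
      ∀ (z0 : Fin m ⊕ Fin n → ℤ) (j0 : Fin n),
      (∀ i, |(g *ᵥ ic z0) i| ≤ |(g *ᵥ ic z0) (Sum.inr j0)|) →
      r0 ≤ |(g *ᵥ ic z0) (Sum.inr j0)| → |(g *ᵥ ic z0) (Sum.inr j0)| ≤ S →
      ∀ N : ℕ, (N : ℝ) ≤ c * Real.exp ((m + n - 1) * T) →
      ∃ f : Fin N → (Fin m → Fin n → ℝ), (∀ k, ‖f k‖ ≤ n + 1 ∧
        (∀ i, ν / 2 ≤ Real.exp (T / m) * |up (f k) (g *ᵥ ic z0) i| ∧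
          Real.exp (T / m) * |up (f k) (g *ᵥ ic z0) i| ≤ ν) ∧
        ∀ z : Fin m ⊕ Fin n → ℤ, (¬ ∃ c : ℝ, ic z = c • ic z0) →
          r' ≤ ‖gm m n T (f k) *ᵥ (g *ᵥ ic z)‖) ∧
        ∀ k l, k ≠ l → s0 * Real.exp (-(T * (1 / m + 1 / n))) ≤ ‖f k - f l‖ := by
  classical
  have hm0 : 0 < m := by omega
  have hmR : (0 : ℝ) < m := by exact_mod_cast hm0
  have hnR : (0 : ℝ) < n := by exact_mod_cast hn
  obtain ⟨T0, hT0⟩ := core_norm_T hm hn r' hr' hsmall (ρ / 2) r0 S ν (by positivity) hr0 hS hν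
  refine ⟨(ν / S / 2 ^ n) ^ m / (4 * (2 * (n * s0)) ^ (n * m)), by positivity, T0, ?_⟩
  intro T hT g hg hlam z0 j0 hwmax hβ0 hβS N hN
  set w := g *ᵥ ic z0 with hw
  set β := w (Sum.inr j0) with hβ
  have hβpos : 0 < |β| := by linarith
  have hβne : β ≠ 0 := abs_pos.mp hβpos
  -- the shear
  let v : Fin m ⊕ Fin n → ℝ := fun i => if i = Sum.inr j0 then 1 else -(w i / β)
  let H : Matrix (Fin m ⊕ Fin n) (Fin m ⊕ Fin n) ℝ :=
    (1 : Matrix (Fin m ⊕ Fin n) (Fin m ⊕ Fin n) ℝ).updateCol (Sum.inr j0) v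
  have hHdet : H.det = 1 := by rw [det_updateCol_one]; simp [v]
  have hwβ : ∀ i, |w i / β| ≤ 1 := by
    intro i; rw [abs_div]; exact div_le_one_of_le₀ (hwmax i) (abs_nonneg _)
  have hHne : ∀ u i, i ≠ Sum.inr j0 → (H *ᵥ u) i = u i - w i / β * u (Sum.inr j0) := by
    intro u i hi
    rw [mulVec_updateCol_one, if_neg hi]
    simp only [v, if_neg hi]; ring
  have hHeq : ∀ u, (H *ᵥ u) (Sum.inr j0) = u (Sum.inr j0) := by
    intro u
    rw [mulVec_updateCol_one, if_pos rfl]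
    simp [v]
  have hHw : H *ᵥ w = Pi.single (Sum.inr j0) β := by
    funext i
    by_cases hi : i = Sum.inr j0
    · subst hi; rw [hHeq]; simp [hβ]
    · rw [hHne _ _ hi, Pi.single_eq_of_ne hi, ← hβ]; field_simp; ring
  have hHnorm : ∀ u, ‖u‖ ≤ 2 * ‖H *ᵥ u‖ := by
    intro u
    rw [pi_norm_le_iff_of_nonneg (by positivity)]
    intro i
    have h1 := norm_le_pi_norm (H *ᵥ u) i
    have h2 := norm_le_pi_norm (H *ᵥ u) (Sum.inr j0)
    rw [hHeq] at h2
    by_cases hi : i = Sum.inr j0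
    · subst hi; linarith [norm_nonneg (H *ᵥ u)]
    · have : u i = (H *ᵥ u) i + w i / β * u (Sum.inr j0) := by rw [hHne _ _ hi]; ring
      rw [this]
      refine (norm_add_le _ _).trans ?_
      rw [norm_mul]
      have h3 : ‖w i / β‖ ≤ 1 := hwβ i
      nlinarith [norm_nonneg (u (Sum.inr j0)), norm_nonneg (w i / β)]
  have hg' : (H * g).det = 1 := by rw [det_mul, hHdet, hg, one_mul]
  set x : ℝ := Real.exp (-(T / m)) with hx
  have hx0 : 0 < x := Real.exp_pos _
  set τ : ℝ := ν * x / |β| with hτ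
  have hτ0 : 0 < τ := by positivity
  let wt : Fin n → ℝ := fun j => if j = j0 then τ else 1
  obtain ⟨hτ1, hbad⟩ := hT0 T hT (H * g) hg' (by
    intro z hz
    rw [← mulVec_mulVec]
    have := hHnorm (g *ᵥ ic z)
    linarith [hlam z hz]) z0 β j0 (by rw [← mulVec_mulVec, ← hw, hHw]) hβ0 hβS wt (fun j => rfl)
  have hwt0 : ∀ j, 0 < wt j := by
    intro j; simp only [wt]; split_ifs <;> linarith
  have hwt1 : ∀ j, wt j ≤ 1 := by
    intro j; simp only [wt]; split_ifs <;> linarith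
  have hprod : ∏ j, (wt j / 2) = τ / 2 ^ n := by
    rw [Finset.prod_div_distrib]
    simp only [Finset.prod_const, Finset.card_univ, Fintype.card_fin]
    congr 1
    rw [← Finset.mul_prod_erase _ _ (Finset.mem_univ j0)]
    rw [Finset.prod_eq_one, mul_one]
    · simp [wt]
    intro j hj
    simp only [wt]
    rw [if_neg (Finset.ne_of_mem_erase hj)]
  set V : ℝ := (∏ j, (wt j / 2)) ^ m with hV
  have hVpos : 0 < V := by rw [hV, hprod]; positivity
  set Bad := {C : Fin m → Fin n → ℝ | (∀ i j, C i j ∈ Set.Icc (wt j / 2) (wt j)) ∧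
        ∃ z : Fin m ⊕ Fin n → ℤ, (¬ ∃ c : ℝ, ic z = c • ic z0) ∧
        (∀ i, |up C ((H * g) *ᵥ ic z) i| < r' * x) ∧
          ∀ j, |((H * g) *ᵥ ic z) (Sum.inr j)| ≤ 2 * r' * Real.exp (T / n)} with hBad
  let Good : Set (Fin m → Fin n → ℝ) := {C | (∀ i j, C i j ∈ Set.Icc (wt j / 2) (wt j)) ∧ C ∉ Bad}
  have hBox : volume {C : Fin m → Fin n → ℝ | ∀ i j, C i j ∈ Set.Icc (wt j / 2) (wt j)} =
      ENNReal.ofReal V := by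
    have : {C : Fin m → Fin n → ℝ | ∀ i j, C i j ∈ Set.Icc (wt j / 2) (wt j)} =
        Set.pi Set.univ (fun _ : Fin m => Set.pi Set.univ
          (fun j : Fin n => Set.Icc (wt j / 2) (wt j))) := by
      ext C
      exact ⟨fun h i _ j _ => h i j, fun h i j => h i trivial j trivial⟩
    rw [this, volume_pi_pi]
    simp only [volume_pi_pi, Real.volume_Icc, Finset.prod_const, Finset.card_univ,
      Fintype.card_fin]
    rw [hV, ENNReal.ofReal_pow (by rw [hprod]; positivity), ENNReal.ofReal_prod_of_nonneg]
    · congr 1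
      apply Finset.prod_congr rfl
      intro j _
      congr 1
      ring
    · intro j _
      linarith [hwt0 j]
  have hGood : ENNReal.ofReal (V / 2) ≤ volume Good := by
    have h1 : ENNReal.ofReal V ≤ volume Good + ENNReal.ofReal (V / 2) := by
      rw [← hBox]
      refine (measure_mono (t := Good ∪ Bad) ?_).trans ((measure_union_le _ _).trans ?_)
      · intro C hC
        by_cases h : C ∈ Bad
        · exact Or.inr h
        · exact Or.inl ⟨hC, h⟩
      · gcongr
    rw [show V = V / 2 + V / 2 by ring, ENNReal.ofReal_add (by positivity) (by positivity)] at h1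
    have h2 : V / 2 / 2 + V / 2 / 2 = V / 2 := by ring
    rw [show (V / 2 + V / 2) / 2 = V / 2 by ring] at h1
    exact (ENNReal.add_le_add_iff_right ENNReal.ofReal_ne_top).mp h1
  set q : ℝ := Real.exp (-(T * (1 / m + 1 / n))) with hq
  have hq0 : 0 < q := Real.exp_pos _
  obtain ⟨f, hfG, hfsep⟩ := exists_separated Good (n * s0 * q) (by positivity) N (by
    refine lt_of_lt_of_le ?_ hGood
    rw [← ENNReal.ofReal_natCast, ← ENNReal.ofReal_mul (by positivity)]
    rw [ENNReal.ofReal_lt_ofReal_iff (by positivity)]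
    have hqpow : q ^ (n * m) = Real.exp (-T) * Real.exp (-((m + n - 1) * T)) := by
      rw [hq, ← Real.exp_nat_mul, ← Real.exp_add]
      congr 1
      push_cast
      field_simp
      ring
    have hVlow : (ν / S / 2 ^ n) ^ m * Real.exp (-T) ≤ V := by
      rw [hV, hprod, ← exp_neg_div_pow hm0 T, ← hx, ← mul_pow]
      apply pow_le_pow_left₀ (by positivity)
      rw [hτ]
      calc ν / S / 2 ^ n * x = ν * x / S / 2 ^ n := by ring
        _ ≤ ν * x / |β| / 2 ^ n := by gcongr
    have : (2 * (n * s0 * q)) ^ (n * m) = (2 * (n * s0)) ^ (n * m) *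
        (Real.exp (-T) * Real.exp (-((m + n - 1) * T))) := by
      rw [← hqpow, ← mul_pow]; congr 1; ring
    rw [this]
    have hE : Real.exp ((m + n - 1) * T) * Real.exp (-((m + n - 1) * T)) = 1 := by
      rw [← Real.exp_add]; simp
    have hpos : 0 < (2 * (n * s0)) ^ (n * m) := by positivity
    calc (N : ℝ) * ((2 * (n * s0)) ^ (n * m) * (Real.exp (-T) * Real.exp (-((m + n - 1) * T))))
        ≤ ((ν / S / 2 ^ n) ^ m / (4 * (2 * (n * s0)) ^ (n * m)) * Real.exp ((m + n - 1) * T)) *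
          ((2 * (n * s0)) ^ (n * m) * (Real.exp (-T) * Real.exp (-((m + n - 1) * T)))) := by
          gcongr
      _ = ((ν / S / 2 ^ n) ^ m * Real.exp (-T)) / 4 *
          (Real.exp ((m + n - 1) * T) * Real.exp (-((m + n - 1) * T))) := by
          field_simp
      _ ≤ V / 4 := by rw [hE, mul_one]; gcongr
      _ < V / 2 := by linarith)
  -- translate back
  let tr : (Fin m → Fin n → ℝ) → (Fin m → Fin n → ℝ) := fun C i j =>
    if j = j0 then C i j0 - (w (Sum.inl i) + ∑ k ∈ Finset.univ.erase j0, C i k * w (Sum.inr k)) / β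
    else C i j
  have htr0 : ∀ C i, tr C i j0 =
      C i j0 - (w (Sum.inl i) + ∑ k ∈ Finset.univ.erase j0, C i k * w (Sum.inr k)) / β := by
    intro C i; simp [tr]
  have htr1 : ∀ C i j, j ≠ j0 → tr C i j = C i j := by
    intro C i j hj; simp [tr, hj]
  have hup : ∀ C u i, up (tr C) u i = up C (H *ᵥ u) i := by
    intro C u i
    have hjn : ∀ j : Fin n, j ≠ j0 → (Sum.inr j : Fin m ⊕ Fin n) ≠ Sum.inr j0 :=
      fun j hj h => hj (Sum.inr_injective h)
    simp only [up]
    rw [← Finset.add_sum_erase _ _ (Finset.mem_univ j0),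
      ← Finset.add_sum_erase _ (fun j => C i j * (H *ᵥ u) (Sum.inr j)) (Finset.mem_univ j0),
      htr0, hHeq, hHne u (Sum.inl i) (by simp)]
    have hs1 : ∑ j ∈ Finset.univ.erase j0, tr C i j * u (Sum.inr j) =
        ∑ j ∈ Finset.univ.erase j0, C i j * u (Sum.inr j) :=
      Finset.sum_congr rfl (fun j hj => by rw [htr1 C i j (Finset.ne_of_mem_erase hj)])
    have hs2 : ∑ j ∈ Finset.univ.erase j0, C i j * (H *ᵥ u) (Sum.inr j) =
        ∑ j ∈ Finset.univ.erase j0, (C i j * u (Sum.inr j) -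
          C i j * w (Sum.inr j) * (u (Sum.inr j0) / β)) :=
      Finset.sum_congr rfl (fun j hj => by
        rw [hHne u (Sum.inr j) (hjn j (Finset.ne_of_mem_erase hj))]; ring)
    rw [hs1, hs2]
    rw [Finset.sum_sub_distrib, ← Finset.sum_mul]
    field_simp
    ring
  have hxe : Real.exp (T / m) * x = 1 := by
    rw [hx, ← Real.exp_add]; simp
  refine ⟨fun k => tr (f k.castSucc), ?_, ?_⟩
  · intro k
    obtain ⟨hC, hCbad⟩ := hfG k.castSucc
    set C := f k.castSucc with hCdef
    change ‖tr C‖ ≤ n + 1 ∧ (∀ i, ν / 2 ≤ Real.exp (T / m) * |up (tr C) w i| ∧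
      Real.exp (T / m) * |up (tr C) w i| ≤ ν) ∧ ∀ z : Fin m ⊕ Fin n → ℤ,
      (¬ ∃ c : ℝ, ic z = c • ic z0) → r' ≤ ‖gm m n T (tr C) *ᵥ (g *ᵥ ic z)‖
    have hCpos : ∀ i j, 0 < C i j := fun i j => lt_of_lt_of_le (by linarith [hwt0 j]) (hC i j).1
    have hC1 : ∀ i j, |C i j| ≤ 1 := fun i j => by
      rw [abs_of_pos (hCpos i j)]; exact (hC i j).2.trans (hwt1 j)
    refine ⟨?_, ?_, ?_⟩
    · rw [pi_norm_le_iff_of_nonneg (by positivity)]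
      intro i
      rw [pi_norm_le_iff_of_nonneg (by positivity)]
      intro j
      rw [Real.norm_eq_abs]
      by_cases hj : j = j0
      · subst hj
        rw [htr0]
        have hs : |∑ k ∈ Finset.univ.erase j, C i k * w (Sum.inr k)| ≤ (n - 1) * |β| := by
          calc _ ≤ ∑ k ∈ Finset.univ.erase j, |C i k * w (Sum.inr k)| :=
                Finset.abs_sum_le_sum_abs _ _
            _ ≤ ∑ k ∈ Finset.univ.erase j, |β| := by
                apply Finset.sum_le_sum
                intro k _
                rw [abs_mul]
                have := hwmax (Sum.inr k)
                have := hC1 i k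
                nlinarith [abs_nonneg (C i k), abs_nonneg (w (Sum.inr k))]
            _ = (n - 1) * |β| := by
                rw [Finset.sum_const, Finset.card_erase_of_mem (Finset.mem_univ _)]
                simp [Nat.cast_sub hn]
        have h2 : |(w (Sum.inl i) + ∑ k ∈ Finset.univ.erase j, C i k * w (Sum.inr k)) / β| ≤ n := by
          rw [abs_div, div_le_iff₀ hβpos]
          refine (abs_add_le _ _).trans ?_
          have := hwmax (Sum.inl i)
          linarith
        refine (abs_sub _ _).trans ?_
        linarith [hC1 i j]
      · rw [htr1 _ _ _ hj]
        linarith [hC1 i j]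
    · intro i
      have h1 : up C (H *ᵥ w) i = C i j0 * β := by
        rw [hHw]
        simp [up, Pi.single_apply]
      rw [hup, h1, abs_mul, abs_of_pos (hCpos i j0)]
      have h2 := (hC i j0).1
      have h3 := (hC i j0).2
      have h4 : wt j0 = τ := by simp [wt]
      rw [h4] at h2 h3
      have h5 : Real.exp (T / m) * (τ * |β|) = ν := by
        rw [hτ, div_mul_cancel₀ _ hβpos.ne']
        calc _ = ν * (Real.exp (T / m) * x) := by ring
          _ = ν := by rw [hxe, mul_one]
      have hep := Real.exp_pos (T / m)
      constructor
      · calc ν / 2 = Real.exp (T / m) * (τ / 2 * |β|) := by rw [← h5]; ring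
          _ ≤ _ := by gcongr
      · rw [← h5]; gcongr
    · intro z hz
      by_contra hcon
      push Not at hcon
      apply hCbad
      have hep := Real.exp_pos (T / m)
      refine ⟨hC, z, hz, ?_, ?_⟩
      · intro i
        rw [← mulVec_mulVec, ← hup]
        have h1 := norm_le_pi_norm (gm m n T (tr C) *ᵥ g *ᵥ ic z) (Sum.inl i)
        rw [gm_inl, Real.norm_eq_abs, abs_mul, abs_of_pos hep] at h1
        have h2 : Real.exp (T / m) * |up (tr C) (g *ᵥ ic z) i| < r' := lt_of_le_of_lt h1 hcon
        calc |up (tr C) (g *ᵥ ic z) i|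
            = (Real.exp (T / m) * |up (tr C) (g *ᵥ ic z) i|) * x := by
              rw [mul_right_comm, hxe, one_mul]
          _ < r' * x := by gcongr
      · have hen : ∀ j, |(g *ᵥ ic z) (Sum.inr j)| ≤ r' * Real.exp (T / n) := by
          intro j
          have h1 := norm_le_pi_norm (gm m n T (tr C) *ᵥ g *ᵥ ic z) (Sum.inr j)
          rw [gm_inr, Real.norm_eq_abs, abs_mul, abs_of_pos (Real.exp_pos _)] at h1
          have h2 := h1.trans hcon.le
          rw [Real.exp_neg, inv_mul_eq_div, div_le_iff₀ (Real.exp_pos _)] at h2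
          exact h2
        intro j
        rw [← mulVec_mulVec]
        have hj0 := hen j0
        have hpos : 0 < r' * Real.exp (T / n) := by positivity
        by_cases hj : j = j0
        · subst hj; rw [hHeq]; linarith
        · rw [hHne _ _ (fun h => hj (Sum.inr_injective h))]
          refine (abs_sub _ _).trans ?_
          rw [abs_mul]
          have := hen j
          have h3 := hwβ (Sum.inr j)
          nlinarith [abs_nonneg (w (Sum.inr j) / β), abs_nonneg ((g *ᵥ ic z) (Sum.inr j0))]
  · intro k l hkl
    have h1 := hfsep k.castSucc l.castSucc (fun h => hkl (Fin.castSucc_injective _ h))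
    set C := f k.castSucc
    set C' := f l.castSucc
    have hent : ∀ i j, |tr C i j - tr C' i j| ≤ ‖tr C - tr C'‖ := fun i j =>
      (norm_le_pi_norm ((tr C - tr C') i) j).trans (norm_le_pi_norm (tr C - tr C') i)
    have hn1 : (1 : ℝ) ≤ n := by exact_mod_cast hn
    have h2 : ‖C - C'‖ ≤ n * ‖tr C - tr C'‖ := by
      rw [pi_norm_le_iff_of_nonneg (by positivity)]
      intro i
      rw [pi_norm_le_iff_of_nonneg (by positivity)]
      intro j
      rw [Real.norm_eq_abs]
      simp only [Pi.sub_apply]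
      by_cases hj : j = j0
      · subst hj
        have h3 : C i j - C' i j = (tr C i j - tr C' i j) +
            ∑ k ∈ Finset.univ.erase j, (tr C i k - tr C' i k) * (w (Sum.inr k) / β) := by
          have : ∑ k ∈ Finset.univ.erase j, (tr C i k - tr C' i k) * (w (Sum.inr k) / β) =
              (∑ k ∈ Finset.univ.erase j, C i k * w (Sum.inr k)) / β -
              (∑ k ∈ Finset.univ.erase j, C' i k * w (Sum.inr k)) / β := by
            rw [Finset.sum_div, Finset.sum_div, ← Finset.sum_sub_distrib]
            apply Finset.sum_congr rfl
            intro k hk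
            rw [htr1 _ _ _ (Finset.ne_of_mem_erase hk), htr1 _ _ _ (Finset.ne_of_mem_erase hk)]
            ring
          rw [this, htr0, htr0]
          ring
        have h4 : |∑ k ∈ Finset.univ.erase j, (tr C i k - tr C' i k) * (w (Sum.inr k) / β)| ≤
            (n - 1) * ‖tr C - tr C'‖ := by
          calc _ ≤ ∑ k ∈ Finset.univ.erase j, |(tr C i k - tr C' i k) * (w (Sum.inr k) / β)| :=
                Finset.abs_sum_le_sum_abs _ _
            _ ≤ ∑ k ∈ Finset.univ.erase j, ‖tr C - tr C'‖ := by
                apply Finset.sum_le_sum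
                intro k _
                rw [abs_mul]
                have := hent i k
                have := hwβ (Sum.inr k)
                nlinarith [abs_nonneg (tr C i k - tr C' i k), abs_nonneg (w (Sum.inr k) / β)]
            _ = (n - 1) * ‖tr C - tr C'‖ := by
                rw [Finset.sum_const, Finset.card_erase_of_mem (Finset.mem_univ _)]
                simp [Nat.cast_sub hn]
        rw [h3]
        refine (abs_add_le _ _).trans ?_
        linarith [hent i j]
      · rw [← htr1 C _ _ hj, ← htr1 C' _ _ hj]
        refine (hent i j).trans ?_
        nlinarith [norm_nonneg (tr C - tr C')]
    have h3 := h1.trans h2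
    rw [mul_assoc] at h3
    exact le_of_mul_le_mul_left h3 hnR

/-- The inductive state: a short vector `z0` with a definite expanding part, everything off its
line being bounded below. -/
structure St {m n : ℕ} (r' ν : ℝ) (g : Matrix (Fin m ⊕ Fin n) (Fin m ⊕ Fin n) ℝ)
    (z0 : Fin m ⊕ Fin n → ℤ) : Prop where
  ne : z0 ≠ 0
  low : ∃ i, ν / 2 ≤ |(g *ᵥ ic z0) (Sum.inl i)|
  upper : ‖g *ᵥ ic z0‖ ≤ ν
  off : ∀ z : Fin m ⊕ Fin n → ℤ, (¬ ∃ c : ℝ, ic z = c • ic z0) → r' ≤ ‖g *ᵥ ic z‖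
  min : ∀ z : Fin m ⊕ Fin n → ℤ, z ≠ 0 → ∀ c : ℝ, ic z = c • ic z0 → 1 ≤ |c|

lemma St.lam {m n : ℕ} {r' ν : ℝ} {g : Matrix (Fin m ⊕ Fin n) (Fin m ⊕ Fin n) ℝ}
    {z0 : Fin m ⊕ Fin n → ℤ} (h : St r' ν g z0) (hν : 0 < ν) (hr : ν ≤ r')
    (z : Fin m ⊕ Fin n → ℤ) (hz : z ≠ 0) : ν / 2 ≤ ‖g *ᵥ ic z‖ := by
  by_cases hc : ∃ c : ℝ, ic z = c • ic z0
  · obtain ⟨c, hc⟩ := hc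
    have h1 := h.min z hz c hc
    obtain ⟨i, hi⟩ := h.low
    have h2 := norm_le_pi_norm (g *ᵥ ic z0) (Sum.inl i)
    rw [Real.norm_eq_abs] at h2
    rw [hc, mulVec_smul, norm_smul, Real.norm_eq_abs]
    nlinarith
  · have := h.off z hc
    linarith

/-- A minimal integer vector on the line of a given one. -/
lemma exists_min_on_line {ι : Type*} [Fintype ι] (z : ι → ℤ) (hz : z ≠ 0) :
    ∃ z0 : ι → ℤ, z0 ≠ 0 ∧ (∃ c : ℝ, ic z0 = c • ic z ∧ |c| ≤ 1) ∧
      ∀ z' : ι → ℤ, z' ≠ 0 → ∀ c : ℝ, ic z' = c • ic z0 → 1 ≤ |c| := by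
  classical
  let N1 : (ι → ℤ) → ℕ := fun z => ∑ i, (z i).natAbs
  have hN : ∀ z : ι → ℤ, (N1 z : ℝ) = ∑ i, |ic z i| := by
    intro z
    simp only [N1, ic, Nat.cast_sum]
    refine Finset.sum_congr rfl fun i _ => ?_
    rw [Nat.cast_natAbs]; push_cast; rfl
  have hNs : ∀ (z z' : ι → ℤ) (c : ℝ), ic z' = c • ic z → (N1 z' : ℝ) = |c| * N1 z := by
    intro z z' c h
    rw [hN, hN, h, Finset.mul_sum]
    simp [abs_mul]
  have hNpos : ∀ z : ι → ℤ, z ≠ 0 → (0 : ℝ) < N1 z := by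
    intro z hz
    obtain ⟨i, hi⟩ := Function.ne_iff.mp hz
    have : 0 < N1 z := by
      refine lt_of_lt_of_le ?_ (Finset.single_le_sum (fun i _ => Nat.zero_le _) (Finset.mem_univ i))
      exact Int.natAbs_pos.mpr hi
    exact_mod_cast this
  let Q : ℕ → Prop := fun k => ∃ y : ι → ℤ, y ≠ 0 ∧ (∃ c : ℝ, ic y = c • ic z) ∧ N1 y = k
  have hQ : ∃ k, Q k := ⟨N1 z, z, hz, ⟨1, by simp⟩, rfl⟩
  obtain ⟨z0, h0, ⟨c, hc⟩, hk⟩ := Nat.find_spec hQ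
  have hmin : ∀ y : ι → ℤ, y ≠ 0 → (∃ c : ℝ, ic y = c • ic z) → N1 z0 ≤ N1 y := by
    intro y hy hc
    rw [hk]
    exact Nat.find_min' hQ ⟨y, hy, hc, rfl⟩
  refine ⟨z0, h0, ⟨c, hc, ?_⟩, ?_⟩
  · have h1 : (N1 z0 : ℝ) ≤ N1 z := by exact_mod_cast hmin z hz ⟨1, by simp⟩
    rw [hNs _ _ _ hc] at h1
    have := hNpos z hz
    by_contra hcon
    push Not at hcon
    nlinarith
  · intro z' hz' c' hc'
    have h1 : (N1 z0 : ℝ) ≤ N1 z' := by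
      exact_mod_cast hmin z' hz' ⟨c' * c, by rw [hc', hc, smul_smul]⟩
    rw [hNs _ _ _ hc'] at h1
    have := hNpos z0 h0
    by_contra hcon
    push Not at hcon
    nlinarith

/-- The next vector. -/
lemma next_vec {m n : ℕ} (hm : 0 < m) {r' ν S : ℝ} (hν : 0 < ν) (hr : ν ≤ r')
    (hS : 0 < S) (hprod : 1 ≤ (ν / 4) * (r' / 2) ^ (m - 1) * S ^ n)
    {g : Matrix (Fin m ⊕ Fin n) (Fin m ⊕ Fin n) ℝ} (hg : g.det = 1)
    {z0 : Fin m ⊕ Fin n → ℤ} (h : St r' ν g z0) :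
    ∃ (z1 : Fin m ⊕ Fin n → ℤ) (j0 : Fin n), z1 ≠ 0 ∧
      (∀ z' : Fin m ⊕ Fin n → ℤ, z' ≠ 0 → ∀ c : ℝ, ic z' = c • ic z1 → 1 ≤ |c|) ∧
      (∀ i, |(g *ᵥ ic z1) i| ≤ |(g *ᵥ ic z1) (Sum.inr j0)|) ∧
      r' ≤ |(g *ᵥ ic z1) (Sum.inr j0)| ∧ |(g *ᵥ ic z1) (Sum.inr j0)| ≤ S := by
  classical
  have : Nonempty (Fin m ⊕ Fin n) := ⟨Sum.inl ⟨0, hm⟩⟩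
  obtain ⟨i0, hi0⟩ := h.low
  let bd : Fin m ⊕ Fin n → ℝ := Sum.elim (fun i => if i = i0 then ν / 4 else r' / 2) (fun _ => S)
  have hbd0 : ∀ i, 0 ≤ bd i := by
    rintro (i | j)
    · simp only [bd, Sum.elim_inl]; split_ifs <;> linarith
    · simp only [bd, Sum.elim_inr]; exact hS.le
  have hbdp : ∏ i, bd i = (ν / 4) * (r' / 2) ^ (m - 1) * S ^ n := by
    rw [Fintype.prod_sum_type]
    simp only [bd, Sum.elim_inl, Sum.elim_inr, Finset.prod_const, Finset.card_univ,
      Fintype.card_fin]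
    congr 1
    rw [← Finset.mul_prod_erase _ _ (Finset.mem_univ i0), if_pos rfl]
    congr 1
    rw [Finset.prod_congr rfl (g := fun _ => r' / 2)
      (fun i hi => if_neg (Finset.ne_of_mem_erase hi))]
    rw [Finset.prod_const, Finset.card_erase_of_mem (Finset.mem_univ _)]
    simp
  obtain ⟨z, hz, hzb⟩ := minkowski_forms g (by rw [hg]; norm_num) bd hbd0
    (by rw [hg, hbdp]; simpa using hprod)
  have hzl : ¬ ∃ c : ℝ, ic z = c • ic z0 := by
    rintro ⟨c, hc⟩
    have h1 := h.min z hz c hc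
    have h2 := hzb (Sum.inl i0)
    simp only [bd, Sum.elim_inl, if_pos] at h2
    rw [hc, mulVec_smul, Pi.smul_apply, smul_eq_mul, abs_mul] at h2
    nlinarith
  obtain ⟨z1, hz1, ⟨c, hc, hc1⟩, hmin⟩ := exists_min_on_line z hz
  have hz1b : ∀ i, |(g *ᵥ ic z1) i| ≤ bd i := by
    intro i
    rw [hc, mulVec_smul, Pi.smul_apply, smul_eq_mul, abs_mul]
    have := hzb i
    nlinarith [abs_nonneg ((g *ᵥ ic z) i), abs_nonneg c]
  have hz1l : ¬ ∃ c : ℝ, ic z1 = c • ic z0 := by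
    rintro ⟨a, ha⟩
    have hc0 : c ≠ 0 := by
      rintro rfl
      rw [zero_smul] at hc
      exact ic_ne_zero hz1 hc
    apply hzl
    refine ⟨c⁻¹ * a, ?_⟩
    rw [← smul_smul, ← ha, hc, smul_smul, inv_mul_cancel₀ hc0, one_smul]
  have hoff := h.off z1 hz1l
  obtain ⟨i1, -, hi1⟩ := Finset.exists_max_image Finset.univ (fun i => |(g *ᵥ ic z1) i|)
    ⟨Sum.inl i0, Finset.mem_univ _⟩
  have hi1n : r' ≤ |(g *ᵥ ic z1) i1| := by
    refine hoff.trans ?_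
    rw [pi_norm_le_iff_of_nonneg (abs_nonneg _)]
    intro i
    exact hi1 i (Finset.mem_univ i)
  rcases i1 with i1 | j0
  · exfalso
    have h2 := hz1b (Sum.inl i1)
    have h3 : bd (Sum.inl i1) ≤ r' / 2 := by
      simp only [bd, Sum.elim_inl]; split_ifs <;> linarith
    linarith
  · exact ⟨z1, j0, hz1, hmin, fun i => hi1 i (Finset.mem_univ i), hi1n, hz1b (Sum.inr j0)⟩

lemma child_state {m n : ℕ} (hm : 0 < m) {r' ν S T : ℝ} (hν : 0 < ν)
    {g : Matrix (Fin m ⊕ Fin n) (Fin m ⊕ Fin n) ℝ} {z1 : Fin m ⊕ Fin n → ℤ} (hz1 : z1 ≠ 0)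
    (hmin : ∀ z' : Fin m ⊕ Fin n → ℤ, z' ≠ 0 → ∀ c : ℝ, ic z' = c • ic z1 → 1 ≤ |c|)
    (hwS : ∀ i, |(g *ᵥ ic z1) i| ≤ S) (hTS : Real.exp (-(T / n)) * S ≤ ν)
    {B : Fin m → Fin n → ℝ}
    (hB : ∀ i, ν / 2 ≤ Real.exp (T / m) * |up B (g *ᵥ ic z1) i| ∧
          Real.exp (T / m) * |up B (g *ᵥ ic z1) i| ≤ ν)
    (hoff : ∀ z : Fin m ⊕ Fin n → ℤ, (¬ ∃ c : ℝ, ic z = c • ic z1) →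
          r' ≤ ‖gm m n T B *ᵥ (g *ᵥ ic z)‖) : St r' ν (gm m n T B * g) z1 := by
  refine ⟨hz1, ⟨⟨0, hm⟩, ?_⟩, ?_, ?_, hmin⟩
  · rw [← mulVec_mulVec, gm_inl, abs_mul, abs_of_pos (Real.exp_pos _)]
    exact (hB _).1
  · rw [← mulVec_mulVec, pi_norm_le_iff_of_nonneg hν.le]
    rintro (i | j)
    · rw [gm_inl, norm_mul, Real.norm_eq_abs, abs_of_pos (Real.exp_pos _)]
      exact (hB _).2
    · rw [gm_inr, norm_mul, Real.norm_eq_abs, abs_of_pos (Real.exp_pos _)]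
      refine le_trans ?_ hTS
      gcongr
      exact hwS _
  · intro z hz
    rw [← mulVec_mulVec]
    exact hoff z hz

lemma abs_up_le {m n : ℕ} (B : Fin m → Fin n → ℝ) (u : Fin m ⊕ Fin n → ℝ) (i : Fin m)
    (M U : ℝ) (hB : ‖B‖ ≤ M) (hu : ∀ i, |u i| ≤ U) : |up B u i| ≤ (1 + n * M) * U := by
  have hM : 0 ≤ M := (norm_nonneg _).trans hB
  have h1 : |∑ j, B i j * u (Sum.inr j)| ≤ n * (M * U) := by
    calc _ ≤ ∑ j, |B i j * u (Sum.inr j)| := Finset.abs_sum_le_sum_abs _ _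
      _ ≤ ∑ _j : Fin n, M * U := by
        refine Finset.sum_le_sum fun j _ => ?_
        rw [abs_mul]
        have h2 : |B i j| ≤ M := ((norm_le_pi_norm (B i) j).trans (norm_le_pi_norm B i)).trans hB
        exact mul_le_mul h2 (hu _) (abs_nonneg _) hM
      _ = n * (M * U) := by simp
  have := hu (Sum.inl i)
  rw [up]
  refine (abs_add_le _ _).trans ?_
  linarith

lemma traj_lower {m n : ℕ} (hn : 0 < n) {M T t : ℝ} (ht0 : 0 ≤ t) (htT : t ≤ T)
    (B : Fin m → Fin n → ℝ) (hB : ‖B‖ ≤ M) (u : Fin m ⊕ Fin n → ℝ) :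
    ‖u‖ ≤ (1 + n * M) * Real.exp T * ‖gm m n t B *ᵥ u‖ := by
  set v := gm m n t B *ᵥ u with hv
  have hM : 0 ≤ M := (norm_nonneg _).trans hB
  have hnR : (1 : ℝ) ≤ n := by exact_mod_cast hn
  have hT : 1 ≤ Real.exp T := Real.one_le_exp (ht0.trans htT)
  have hr : ∀ j, |u (Sum.inr j)| ≤ Real.exp T * ‖v‖ := by
    intro j
    have h1 := norm_le_pi_norm v (Sum.inr j)
    rw [hv, gm_inr, ← hv, Real.norm_eq_abs, abs_mul, abs_of_pos (Real.exp_pos _), Real.exp_neg,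
      inv_mul_eq_div, div_le_iff₀ (Real.exp_pos _)] at h1
    refine h1.trans ?_
    rw [mul_comm]
    gcongr
    exact (div_le_self ht0 hnR).trans htT
  have hnM : 0 ≤ n * M := by positivity
  rw [pi_norm_le_iff_of_nonneg (by positivity)]
  rintro (i | j)
  · have h1 := norm_le_pi_norm v (Sum.inl i)
    rw [hv, gm_inl, ← hv, Real.norm_eq_abs, abs_mul, abs_of_pos (Real.exp_pos _)] at h1
    have h2 : 1 ≤ Real.exp (t / m) := Real.one_le_exp (by positivity)
    have h3 : |up B u i| ≤ ‖v‖ := by nlinarith [abs_nonneg (up B u i)]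
    have h4 : |∑ j, B i j * u (Sum.inr j)| ≤ n * (M * (Real.exp T * ‖v‖)) := by
      calc _ ≤ ∑ j, |B i j * u (Sum.inr j)| := Finset.abs_sum_le_sum_abs _ _
        _ ≤ ∑ _j : Fin n, M * (Real.exp T * ‖v‖) := by
          refine Finset.sum_le_sum fun j _ => ?_
          rw [abs_mul]
          have h2 : |B i j| ≤ M := ((norm_le_pi_norm (B i) j).trans (norm_le_pi_norm B i)).trans hB
          exact mul_le_mul h2 (hr _) (abs_nonneg _) hM
        _ = _ := by simp
    have h5 : u (Sum.inl i) = up B u i - ∑ j, B i j * u (Sum.inr j) := by rw [up]; ring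
    rw [Real.norm_eq_abs, h5]
    refine (abs_sub _ _).trans ?_
    nlinarith [norm_nonneg v]
  · refine (hr j).trans ?_
    have : 0 ≤ Real.exp T * ‖v‖ := by positivity
    nlinarith

lemma traj_upper {m n : ℕ} (hm : 0 < m) (hn : 0 < n) {r' ν η S T t M M1 : ℝ} (hν : 0 < ν)
    (hη : 0 < η) (hS : 0 < S) (h2ν : 2 * ν ≤ η) (hM1 : 0 ≤ M1)
    {g : Matrix (Fin m ⊕ Fin n) (Fin m ⊕ Fin n) ℝ} {z0 z1 : Fin m ⊕ Fin n → ℤ}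
    (h : St r' ν g z0) (hz1 : z1 ≠ 0) (hwS : ∀ i, |(g *ᵥ ic z1) i| ≤ S)
    (hTS2 : n * M1 * S * Real.exp (-(T / n)) ≤ ν)
    (hSη : S ^ n * ((1 + n * M) * ν) ^ m ≤ η ^ (m + n))
    {B B' : Fin m → Fin n → ℝ}
    (hB : ∀ i, Real.exp (T / m) * |up B (g *ᵥ ic z1) i| ≤ ν)
    (hB' : ‖B'‖ ≤ M) (hBB : ‖B' - B‖ ≤ M1 * Real.exp (-(T * (1 / m + 1 / n))))
    (ht0 : 0 ≤ t) (htT : t ≤ T) : ∃ z : Fin m ⊕ Fin n → ℤ, z ≠ 0 ∧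
      ‖gm m n t B' *ᵥ (g *ᵥ ic z)‖ ≤ η := by
  have hM : 0 ≤ M := (norm_nonneg _).trans hB'
  have hmR : (0 : ℝ) < m := by exact_mod_cast hm
  have hnR : (0 : ℝ) < n := by exact_mod_cast hn
  have hK : 1 ≤ 1 + n * M := by nlinarith
  have het : 1 ≤ Real.exp (t / m) := Real.one_le_exp (by positivity)
  have hent : Real.exp (-(t / n)) ≤ 1 := Real.exp_le_one_iff.mpr (by
    have : 0 ≤ t / n := by positivity
    linarith)
  by_cases hc : Real.exp (t / m) * ((1 + n * M) * ν) ≤ η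
  · refine ⟨z0, h.ne, ?_⟩
    have hu : ∀ i, |(g *ᵥ ic z0) i| ≤ ν := fun i => (norm_le_pi_norm _ i).trans h.upper
    rw [pi_norm_le_iff_of_nonneg hη.le]
    rintro (i | j)
    · rw [gm_inl, norm_mul, Real.norm_eq_abs, Real.norm_eq_abs, abs_of_pos (Real.exp_pos _)]
      refine le_trans ?_ hc
      gcongr
      exact abs_up_le _ _ _ _ _ hB' hu
    · rw [gm_inr, norm_mul, Real.norm_eq_abs, Real.norm_eq_abs, abs_of_pos (Real.exp_pos _)]
      have := hu (Sum.inr j)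
      nlinarith [abs_nonneg ((g *ᵥ ic z0) (Sum.inr j)), Real.exp_pos (-(t / n))]
  · push Not at hc
    refine ⟨z1, hz1, ?_⟩
    set w := g *ᵥ ic z1
    rw [pi_norm_le_iff_of_nonneg hη.le]
    rintro (i | j)
    · rw [gm_inl, norm_mul, Real.norm_eq_abs, Real.norm_eq_abs, abs_of_pos (Real.exp_pos _)]
      have h1 : up B' w i = up B w i + ∑ j, (B' - B) i j * w (Sum.inr j) := by
        simp only [up, Pi.sub_apply, sub_mul, Finset.sum_sub_distrib]; ring
      have h2 : |∑ j, (B' - B) i j * w (Sum.inr j)| ≤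
          n * (M1 * Real.exp (-(T * (1 / m + 1 / n))) * S) := by
        calc _ ≤ ∑ j, |(B' - B) i j * w (Sum.inr j)| := Finset.abs_sum_le_sum_abs _ _
          _ ≤ ∑ _j : Fin n, M1 * Real.exp (-(T * (1 / m + 1 / n))) * S := by
            refine Finset.sum_le_sum fun j _ => ?_
            rw [abs_mul]
            have h2 : |(B' - B) i j| ≤ M1 * Real.exp (-(T * (1 / m + 1 / n))) :=
              ((norm_le_pi_norm ((B' - B) i) j).trans (norm_le_pi_norm (B' - B) i)).trans hBB
            exact mul_le_mul h2 (hwS _) (abs_nonneg _) (by positivity)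
          _ = _ := by simp
      have h3 : Real.exp (T / m) * Real.exp (-(T * (1 / m + 1 / n))) = Real.exp (-(T / n)) := by
        rw [← Real.exp_add]; congr 1; field_simp; ring
      calc Real.exp (t / m) * |up B' w i| ≤ Real.exp (T / m) * |up B' w i| := by gcongr
        _ ≤ Real.exp (T / m) * (|up B w i| +
            n * (M1 * Real.exp (-(T * (1 / m + 1 / n))) * S)) := by
            gcongr
            rw [h1]
            exact (abs_add_le _ _).trans (by linarith)
        _ = Real.exp (T / m) * |up B w i| + n * M1 * S *
            (Real.exp (T / m) * Real.exp (-(T * (1 / m + 1 / n)))) := by ring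
        _ ≤ ν + ν := by rw [h3]; exact add_le_add (hB i) hTS2
        _ ≤ η := by linarith
    · rw [gm_inr, norm_mul, Real.norm_eq_abs, Real.norm_eq_abs, abs_of_pos (Real.exp_pos _)]
      refine le_trans (mul_le_mul_of_nonneg_left (hwS _) (Real.exp_pos _).le) ?_
      refine le_of_pow_le_pow_left₀ hn.ne' hη.le ?_
      rw [mul_pow, exp_neg_div_pow hn, Real.exp_neg, inv_mul_eq_div, div_le_iff₀ (Real.exp_pos _)]
      have h1 : η ^ m ≤ Real.exp t * ((1 + n * M) * ν) ^ m := by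
        rw [← exp_div_pow hm t, ← mul_pow]
        exact pow_le_pow_left₀ hη.le hc.le m
      have h2 : 0 < ((1 + n * M) * ν) ^ m := by positivity
      refine le_of_mul_le_mul_right ?_ h2
      calc _ ≤ η ^ (m + n) := hSη
        _ = η ^ n * η ^ m := by rw [pow_add, mul_comm]
        _ ≤ η ^ n * (Real.exp t * ((1 + n * M) * ν) ^ m) := by gcongr
        _ = _ := by ring

lemma step_all {m n : ℕ} (hm : 2 ≤ m) (hn : 0 < n) (η : ℝ) (hη : 0 < η) :
    ∃ ν : ℝ, 0 < ν ∧ ∃ r' : ℝ, ∃ c : ℝ, 0 < c ∧ ∃ T1 : ℝ, ∀ T ≥ T1,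
      (∃ (a0 : Fin m → Fin n → ℝ) (z0 : Fin m ⊕ Fin n → ℤ), St r' ν (gm m n T a0) z0) ∧
      ∀ (g : Matrix (Fin m ⊕ Fin n) (Fin m ⊕ Fin n) ℝ) (z0 : Fin m ⊕ Fin n → ℤ), g.det = 1 →
        St r' ν g z0 → ∀ N : ℕ, (N : ℝ) ≤ c * Real.exp ((m + n - 1) * T) →
        ∃ f : Fin N → (Fin m → Fin n → ℝ), (∀ k, ‖f k‖ ≤ n + 1 ∧
          (∃ z1, St r' ν (gm m n T (f k) * g) z1) ∧
          ∀ B' : Fin m → Fin n → ℝ,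
            ‖B' - f k‖ ≤ 2 * (n + 1) * Real.exp (-(T * (1 / m + 1 / n))) →
            ∀ t, 0 ≤ t → t ≤ T →
              (∀ z : Fin m ⊕ Fin n → ℤ, z ≠ 0 →
                ν / (2 * (1 + n * (n + 2)) * Real.exp T) ≤ ‖gm m n t B' *ᵥ (g *ᵥ ic z)‖) ∧
              ∃ z : Fin m ⊕ Fin n → ℤ, z ≠ 0 ∧ ‖gm m n t B' *ᵥ (g *ᵥ ic z)‖ ≤ η) ∧
          ∀ k l, k ≠ l →
            8 * (n + 1) * Real.exp (-(T * (1 / m + 1 / n))) ≤ ‖f k - f l‖ := by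
  classical
  have hm0 : 0 < m := by omega
  have hmR : (0 : ℝ) < m := by exact_mod_cast hm0
  have hnR : (0 : ℝ) < n := by exact_mod_cast hn
  have hnR1 : (1 : ℝ) ≤ n := by exact_mod_cast hn
  -- choice of the radius
  set C : ℝ := (16 * (2 * ((n : ℝ) + 2))) ^ m * 8 ^ n with hC
  have hCpos : 0 < C := by positivity
  obtain ⟨r', hr', hr'1, hr'C⟩ : ∃ r' : ℝ, 0 < r' ∧ r' ≤ 1 ∧ r' ≤ 1 / (4 * C) :=
    ⟨min 1 (1 / (4 * C)), by positivity, min_le_left _ _, min_le_right _ _⟩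
  have hsmall : C * r' ^ (m + n) ≤ 1 / 4 := by
    have h1 : r' ^ (m + n) ≤ r' := pow_le_of_le_one hr'.le hr'1 (by omega)
    calc C * r' ^ (m + n) ≤ C * (1 / (4 * C)) := by gcongr; exact h1.trans hr'C
      _ = 1 / 4 := by field_simp
  -- choice of ν
  set K2 : ℝ := 1 + n * (n + 2) with hK2
  have hK2pos : 0 < K2 := by positivity
  set s : ℝ := r' / 2 with hs
  have hspos : 0 < s := by positivity
  set X : ℝ := η ^ (m + n) * s ^ (m - 1) / (4 * K2 ^ m) with hX
  have hXpos : 0 < X := by positivity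
  obtain ⟨ν, hν, hν1, hνr, hνη, hνX⟩ : ∃ ν : ℝ, 0 < ν ∧ ν ≤ 1 ∧ ν ≤ r' ∧ ν ≤ η / 2 ∧ ν ≤ X :=
    ⟨min (min 1 r') (min (η / 2) X), by positivity, by simp, by simp, by simp, by simp⟩
  set S : ℝ := (4 / (ν * s ^ (m - 1))) ^ ((n : ℝ)⁻¹) with hSdef
  have hSpos : 0 < S := by positivity
  have hSn : S ^ n = 4 / (ν * s ^ (m - 1)) := Real.rpow_inv_natCast_pow (by positivity) hn.ne'
  have hprod : 1 ≤ (ν / 4) * (r' / 2) ^ (m - 1) * S ^ n := by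
    rw [hSn, ← hs]
    apply le_of_eq
    field_simp
  have hSη : S ^ n * ((1 + n * ((n : ℝ) + 2)) * ν) ^ m ≤ η ^ (m + n) := by
    rw [hSn, ← hK2, mul_pow]
    have h1 : ν ^ m = ν ^ (m - 1) * ν := by rw [← pow_succ]; congr 1; omega
    have h2 : ν ^ (m - 1) ≤ ν := pow_le_of_le_one hν.le hν1 (by omega)
    calc 4 / (ν * s ^ (m - 1)) * (K2 ^ m * ν ^ m) = 4 * K2 ^ m / s ^ (m - 1) * ν ^ (m - 1) := by
          rw [h1]; field_simp
      _ ≤ 4 * K2 ^ m / s ^ (m - 1) * X := by gcongr; exact h2.trans hνX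
      _ = η ^ (m + n) := by rw [hX]; field_simp
  obtain ⟨c, hc, T0, hT0⟩ := core_step hm hn r' hr' hsmall (ν / 2) r' S ν (8 * (n + 1))
    (by positivity) hr' hSpos hν (by positivity)
  obtain ⟨c', hc', T0', hT0'⟩ := core_step hm hn r' hr' hsmall 1 1 1 ν (8 * (n + 1))
    (by positivity) one_pos one_pos hν (by positivity)
  have hlim : Tendsto (fun T : ℝ => Real.exp (-(T / n))) atTop (𝓝 0) := by
    apply Real.tendsto_exp_neg_atTop_nhds_zero.comp
    exact tendsto_id.atTop_div_const hnR
  have hd : (0 : ℝ) < m + n - 1 := by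
    have : (2 : ℝ) ≤ m := by exact_mod_cast hm
    linarith
  have hlim2 : Tendsto (fun T : ℝ => Real.exp ((m + n - 1) * T)) atTop atTop :=
    Real.tendsto_exp_atTop.comp (tendsto_id.const_mul_atTop hd)
  have hev := (eventually_ge_atTop T0).and ((eventually_ge_atTop T0').and
    ((eventually_ge_atTop (0 : ℝ)).and
    ((hlim.eventually (gt_mem_nhds (show (0 : ℝ) < ν / S by positivity))).and
    ((hlim.eventually (gt_mem_nhds hν)).and
    ((hlim.eventually (gt_mem_nhds (show (0 : ℝ) < ν / (n * (2 * (n + 1)) * S) by positivity))).and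
    ((hlim.eventually (gt_mem_nhds (show (0 : ℝ) < 1 / (2 * (n + 1)) by positivity))).and
    (hlim2.eventually_ge_atTop (1 / c'))))))))
  obtain ⟨T1, hT1⟩ := eventually_atTop.mp hev
  refine ⟨ν, hν, r', c, hc, T1, ?_⟩
  intro T hT
  obtain ⟨e1, e2, e3, e4, e5, e6, e7, e8⟩ := hT1 T hT
  refine ⟨?_, ?_⟩
  · -- initial state
    let j0 : Fin n := ⟨0, hn⟩
    let z0 : Fin m ⊕ Fin n → ℤ := Pi.single (Sum.inr j0) 1
    have hz00 : z0 (Sum.inr j0) = 1 := by simp [z0]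
    have hz0i : ∀ i, i ≠ Sum.inr j0 → z0 i = 0 := fun i hi => by simp [z0, hi]
    have hz0 : z0 ≠ 0 := by
      intro h
      rw [h] at hz00
      simp at hz00
    have hle : ∀ i, |ic z0 i| ≤ 1 := by
      intro i
      by_cases hi : i = Sum.inr j0
      · simp [ic, hi, hz00]
      · simp [ic, hz0i i hi]
    have h1 : |ic z0 (Sum.inr j0)| = 1 := by simp [ic, hz00]
    obtain ⟨f, hf, -⟩ := hT0' T e2 1 det_one (by
      intro z hz
      rw [one_mulVec]
      obtain ⟨i, hi⟩ := Function.ne_iff.mp hz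
      refine le_trans ?_ (norm_le_pi_norm (ic z) i)
      rw [Real.norm_eq_abs, ic]
      have : 1 ≤ |z i| := Int.one_le_abs hi
      exact_mod_cast this) z0 j0 (by
      intro i
      rw [one_mulVec, h1]
      exact hle i) (by rw [one_mulVec, h1]) (by rw [one_mulVec, h1]) 1 (by
      rw [div_le_iff₀ hc'] at e8
      push_cast
      linarith)
    obtain ⟨-, hf2, hf3⟩ := hf 0
    refine ⟨f 0, z0, ?_⟩
    have := child_state (T := T) (S := 1) (g := 1) hm0 hν hz0 (by
      intro z' hz' a ha
      have h2 : (z' (Sum.inr j0) : ℝ) = a := by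
        have := congrFun ha (Sum.inr j0)
        simpa [ic, hz00] using this
      have h3 : z' (Sum.inr j0) ≠ 0 := by
        intro h3
        rw [h3] at h2
        have ha0 : a = 0 := by rw [← h2]; simp
        rw [ha0, zero_smul] at ha
        exact ic_ne_zero hz' ha
      have : 1 ≤ |z' (Sum.inr j0)| := Int.one_le_abs h3
      rw [← h2]
      exact_mod_cast this) (by
      intro i
      rw [one_mulVec]
      exact hle i) (by rw [mul_one]; exact e5.le) hf2 hf3
    rwa [mul_one] at this
  · intro g z0 hg hSt N hN
    obtain ⟨z1, j0, hz1, hmin, hmax, hlo, hhi⟩ := next_vec hm0 hν hνr hSpos hprod hg hSt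
    obtain ⟨f, hf, hsep⟩ :=
      hT0 T e1 g hg (fun z hz => hSt.lam hν hνr z hz) z1 j0 hmax hlo hhi N hN
    refine ⟨f, ?_, hsep⟩
    intro k
    obtain ⟨h1, h2, h3⟩ := hf k
    have hwS : ∀ i, |(g *ᵥ ic z1) i| ≤ S := fun i => (hmax i).trans hhi
    refine ⟨h1, ⟨z1, child_state hm0 hν hz1 hmin hwS ?_ h2 h3⟩, ?_⟩
    · rw [lt_div_iff₀ hSpos] at e4
      exact e4.le
    intro B' hB' t ht0 htT
    have hqle : Real.exp (-(T * (1 / m + 1 / n))) ≤ Real.exp (-(T / n)) := by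
      apply Real.exp_le_exp.mpr
      have : 0 ≤ T * (1 / m) := by positivity
      have h4 : T * (1 / m + 1 / n) = T * (1 / m) + T / n := by ring
      linarith
    have hB'n : ‖B'‖ ≤ n + 2 := by
      have h4 : ‖B'‖ ≤ ‖B' - f k‖ + ‖f k‖ := by
        simpa using norm_add_le (B' - f k) (f k)
      rw [lt_div_iff₀ (by positivity)] at e7
      have h5 : 2 * ((n : ℝ) + 1) * Real.exp (-(T * (1 / m + 1 / n))) ≤
        2 * ((n : ℝ) + 1) * Real.exp (-(T / n)) := by gcongr
      linarith
    refine ⟨?_, ?_⟩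
    · intro z hz
      have h4 := hSt.lam hν hνr z hz
      have h5 := traj_lower hn ht0 htT B' hB'n (g *ᵥ ic z)
      rw [div_le_iff₀ (by positivity)]
      rw [← hK2] at h5
      linarith
    · refine traj_upper (r' := r') (M := n + 2) (M1 := 2 * (n + 1)) hm0 hn hν hη hSpos
        (by linarith) (by positivity) hSt hz1 hwS ?_ hSη (fun i => (h2 i).2) hB'n hB' ht0 htT
      rw [lt_div_iff₀ (by positivity)] at e6
      linarith

lemma main_ge2 {m n : ℕ} (hm : 2 ≤ m) (hn : 0 < n) (η ε : ℝ) (hη : 0 < η) (hε : 0 < ε) :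
    ∃ ρ : ℝ, 0 < ρ ∧ ∃ tc : ℕ, ENNReal.ofReal ((m : ℝ) * n - (m : ℝ) * n / ((m : ℝ) + n) - ε) ≤
      dimH {A : Fin m → Fin n → ℝ | ∀ t : ℝ, (tc : ℝ) ≤ t →
        (∀ z : Fin m ⊕ Fin n → ℤ, z ≠ 0 → ρ ≤ ‖gm m n t A *ᵥ ic z‖) ∧
        ∃ z : Fin m ⊕ Fin n → ℤ, z ≠ 0 ∧ ‖gm m n t A *ᵥ ic z‖ ≤ η} := by
  classical
  have hm0 : 0 < m := by omega
  have hmR : (0 : ℝ) < m := by exact_mod_cast hm0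
  have hnR : (0 : ℝ) < n := by exact_mod_cast hn
  obtain ⟨ν, hν, r', c, hc, T1, hT1⟩ := step_all hm hn η hη
  set κ : ℝ := 1 / m + 1 / n with hκ
  have hκ0 : 0 < κ := by positivity
  have hd : (0 : ℝ) < m + n - 1 := by
    have : (2 : ℝ) ≤ m := by exact_mod_cast hm
    linarith
  have hlim1 : Tendsto (fun T : ℝ => Real.exp (T * κ)) atTop atTop :=
    Real.tendsto_exp_atTop.comp (tendsto_id.atTop_mul_const hκ0)
  have hlim2 : Tendsto (fun T : ℝ => Real.exp ((m + n - 1) * T)) atTop atTop :=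
    Real.tendsto_exp_atTop.comp (tendsto_id.const_mul_atTop hd)
  obtain ⟨T, e1, e2, e3, e4, e5⟩ := ((eventually_ge_atTop T1).and
    ((eventually_ge_atTop (1 : ℝ)).and ((eventually_ge_atTop (-Real.log (c / 2) / (κ * ε))).and
    ((hlim1.eventually_ge_atTop 2).and (hlim2.eventually_ge_atTop (3 / c)))))).exists
  have hT0 : 0 < T := by linarith
  obtain ⟨⟨a0, z0, hinit⟩, hstep⟩ := hT1 T e1
  set L : ℝ := Real.exp (T * κ) with hL
  have hLpos : 0 < L := Real.exp_pos _
  have hLi : L⁻¹ = Real.exp (-(T * κ)) := by rw [hL, Real.exp_neg]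
  have hLk : ∀ k : ℕ, L⁻¹ ^ k = Real.exp (-((k * T) * κ)) := by
    intro k
    rw [hLi, ← Real.exp_nat_mul]; congr 1; ring
  set Y : ℝ := c * Real.exp ((m + n - 1) * T) with hY
  have hY3 : 3 ≤ Y := by
    rw [div_le_iff₀ hc] at e5
    linarith
  set N : ℕ := ⌊Y⌋₊ with hN
  have hNY : (N : ℝ) ≤ Y := Nat.floor_le (by linarith)
  have hNY2 : Y / 2 ≤ N := by
    have := Nat.lt_floor_add_one Y
    rw [← hN] at this
    linarith
  have hN2 : 2 ≤ N := Nat.le_floor (by norm_num; linarith)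
  set ρ : ℝ := ν / (2 * (1 + n * (n + 2)) * Real.exp T) with hρ
  have hρ0 : 0 < ρ := by positivity
  set M0 : ℝ := n + 1 with hM0
  have hM0pos : 0 < M0 := by positivity
  let P : ℕ → (Fin m → Fin n → ℝ) → Prop := fun k a =>
    ∃ z0, St r' ν (gm m n ((k + 1 : ℕ) * T) a) z0
  let Rel : ℕ → (Fin m → Fin n → ℝ) → (Fin m → Fin n → ℝ) → Prop := fun k _ a' =>
    ∀ A : Fin m → Fin n → ℝ, ‖A - a'‖ ≤ 2 * (M0 * L⁻¹) * L⁻¹ ^ (k + 1) →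
      ∀ t, ((k + 1 : ℕ) : ℝ) * T ≤ t → t ≤ ((k + 1 : ℕ) : ℝ) * T + T →
      (∀ z : Fin m ⊕ Fin n → ℤ, z ≠ 0 → ρ ≤ ‖gm m n t A *ᵥ ic z‖) ∧
        ∃ z : Fin m ⊕ Fin n → ℤ, z ≠ 0 ∧ ‖gm m n t A *ᵥ ic z‖ ≤ η
  have key := cantor_dim P Rel N hN2 L (M0 * L⁻¹) (8 * M0 * L⁻¹ * L⁻¹) e4 (by positivity)
    (by positivity) (le_of_eq (by ring)) a0 (by
      refine ⟨z0, ?_⟩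
      simpa using hinit) (by
      rintro k a ⟨z0, hSt⟩
      obtain ⟨f, hf, hsep⟩ := hstep _ z0 (gm_det hm0 hn _ _) hSt N hNY
      set q : ℝ := L⁻¹ ^ (k + 1) with hq
      have hq0 : 0 < q := by positivity
      have hmul : ∀ t B, gm m n t B * gm m n ((k + 1 : ℕ) * T) a =
          gm m n ((k + 1 : ℕ) * T + t) (a + q • B) := by
        intro t B
        rw [gm_mul, hq, hLk]
      refine ⟨fun i => a + q • f i, ?_, ?_⟩
      · intro i
        obtain ⟨h1, ⟨z1, h2⟩, h3⟩ := hf i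
        refine ⟨⟨z1, ?_⟩, ?_, ?_⟩
        · rw [hmul] at h2
          have : ((k + 1 + 1 : ℕ) : ℝ) * T = (k + 1 : ℕ) * T + T := by push_cast; ring
          rwa [this]
        · intro A hA t ht1 ht2
          set B' := q⁻¹ • (A - a) with hB'
          have hA' : A = a + q • B' := by
            rw [hB', smul_smul, mul_inv_cancel₀ hq0.ne', one_smul]; abel
          have hB2 : B' - f i = q⁻¹ • (A - (a + q • f i)) := by
            rw [hB', sub_add_eq_sub_sub, smul_sub q⁻¹ (A - a), smul_smul,
              inv_mul_cancel₀ hq0.ne', one_smul]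
          have h4 : ‖B' - f i‖ ≤ 2 * (n + 1) * Real.exp (-(T * (1 / m + 1 / n))) := by
            rw [hB2, norm_smul, Real.norm_eq_abs, abs_of_pos (by positivity), ← hκ, ← hLi]
            calc q⁻¹ * ‖A - (a + q • f i)‖ ≤ q⁻¹ * (2 * (M0 * L⁻¹) * q) := by gcongr
              _ = 2 * (n + 1) * L⁻¹ := by rw [hM0]; field_simp
          have h5 := h3 B' h4 (t - (k + 1 : ℕ) * T) (by linarith) (by linarith)
          simp only [mulVec_mulVec, hmul, ← hA', add_sub_cancel] at h5
          exact h5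
        · simp only [add_sub_cancel_left]
          rw [norm_smul, Real.norm_eq_abs, abs_of_pos hq0]
          calc q * ‖f i‖ ≤ q * M0 := by gcongr
            _ = M0 * L⁻¹ * L⁻¹ ^ k := by rw [hq, pow_succ]; ring
      · intro i j hij
        have h1 := hsep i j hij
        have h2 : a + q • f i - (a + q • f j) = q • (f i - f j) := by
          rw [smul_sub]; abel
        rw [h2, norm_smul, Real.norm_eq_abs, abs_of_pos hq0]
        rw [← hLi] at h1
        calc 8 * M0 * L⁻¹ * L⁻¹ * L⁻¹ ^ k = q * (8 * M0 * L⁻¹) := by rw [hq, pow_succ]; ring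
          _ ≤ _ := by gcongr)
  refine ⟨ρ, hρ0, ⌈T⌉₊, ?_⟩
  refine le_trans ?_ (key.trans (dimH_mono ?_))
  · apply ENNReal.ofReal_le_ofReal
    have hlogL : Real.log L = T * κ := by rw [hL, Real.log_exp]
    rw [hlogL, le_div_iff₀ (by positivity)]
    have h1 : Real.log (Y / 2) ≤ Real.log N := Real.log_le_log (by linarith) hNY2
    have h2 : Real.log (Y / 2) = Real.log (c / 2) + (m + n - 1) * T := by
      rw [hY, show c * Real.exp ((m + n - 1) * T) / 2 = (c / 2) * Real.exp ((m + n - 1) * T) by ring,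
        Real.log_mul (by positivity) (Real.exp_pos _).ne', Real.log_exp]
    rw [div_le_iff₀ (by positivity)] at e3
    have h3 : ((m : ℝ) * n - (m : ℝ) * n / ((m : ℝ) + n) - ε) * (T * κ) =
        (m + n - 1) * T - T * (κ * ε) := by
      rw [hκ]; field_simp; ring
    linarith
  · rintro A ⟨a, -, ha⟩ t ht
    have htT : T ≤ t := (Nat.le_ceil T).trans ht
    have hq1 : 1 ≤ ⌊t / T⌋₊ := Nat.le_floor (by rw [Nat.cast_one, le_div_iff₀ hT0]; linarith)
    obtain ⟨k, hk⟩ := Nat.exists_eq_add_of_le' hq1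
    have h1 : ((k + 1 : ℕ) : ℝ) * T ≤ t := by
      rw [← le_div_iff₀ hT0, ← hk]
      exact Nat.floor_le (div_nonneg (by linarith) hT0.le)
    have h2 : t ≤ ((k + 1 : ℕ) : ℝ) * T + T := by
      have := Nat.lt_floor_add_one (t / T)
      rw [hk, div_lt_iff₀ hT0] at this
      linarith
    exact (ha k).2.1 A (ha (k + 1)).2.2 t h1 h2

/-- Transference. -/
lemma transference {ι : Type*} [Fintype ι] [DecidableEq ι] [Nonempty ι] (g h : Matrix ι ι ℝ)
    (hg : g.det = 1) (hgh : gᵀ * h = 1) (ζ M : ℝ) (hM : 0 ≤ M)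
    (hζM : 2 * ζ ≤ M ^ (Fintype.card ι - 1)) (z : ι → ℤ) (hz : z ≠ 0) (hzζ : ‖h *ᵥ ic z‖ ≤ ζ) :
    ∃ f : ι → ℤ, f ≠ 0 ∧ ‖g *ᵥ ic f‖ ≤ Fintype.card ι * M := by
  set w := h *ᵥ ic z with hw
  have hgw : gᵀ *ᵥ w = ic z := by rw [hw, mulVec_mulVec, hgh, one_mulVec]
  have hw0 : w ≠ 0 := by
    intro h0
    rw [h0, mulVec_zero] at hgw
    exact ic_ne_zero hz hgw.symm
  obtain ⟨i, -, hi⟩ := Finset.exists_max_image Finset.univ (fun i => |w i|)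
    (Finset.univ_nonempty (α := ι))
  have hwi : 0 < |w i| := by
    obtain ⟨k, hk⟩ := Function.ne_iff.mp hw0
    exact lt_of_lt_of_le (abs_pos.mpr hk) (hi k (Finset.mem_univ k))
  have hwiζ : |w i| ≤ ζ := (norm_le_pi_norm w i).trans hzζ
  let R : Matrix ι ι ℝ := (1 : Matrix ι ι ℝ).updateRow i w
  have hR : R.det = w i := det_updateRow_one' i w
  let bd : ι → ℝ := fun k => if k = i then 1 / 2 else M
  have hbd : ∏ k, bd k = 1 / 2 * M ^ (Fintype.card ι - 1) := by
    rw [← Finset.mul_prod_erase _ _ (Finset.mem_univ i)]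
    simp only [bd, if_pos]
    congr 1
    rw [Finset.prod_congr rfl (g := fun _ => M) (fun k hk => if_neg (Finset.ne_of_mem_erase hk)),
      Finset.prod_const, Finset.card_erase_of_mem (Finset.mem_univ _), Finset.card_univ]
  obtain ⟨f, hf, hfb⟩ := minkowski_forms (R * g)
    (by rw [det_mul, hR, hg, mul_one]; exact abs_pos.mp hwi) bd
    (fun k => by simp only [bd]; split_ifs <;> linarith)
    (by rw [det_mul, hR, hg, mul_one, hbd]; linarith)
  refine ⟨f, hf, ?_⟩
  set u := g *ᵥ ic f with hu
  have hk : ∀ k, k ≠ i → |u k| ≤ M := by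
    intro k hk
    have h1 := hfb k
    rw [← mulVec_mulVec, ← hu, updateRow_one_mulVec_ne hk] at h1
    simpa [bd, hk] using h1
  have hdot : w ⬝ᵥ u = ((∑ k, z k * f k : ℤ) : ℝ) := by
    rw [hu, dotProduct_mulVec, ← mulVec_transpose, hgw]
    simp [dotProduct, ic]
  have hdot0 : w ⬝ᵥ u = 0 := by
    have h1 := hfb i
    rw [← mulVec_mulVec, ← hu, updateRow_one_mulVec_same] at h1
    change |w ⬝ᵥ u| ≤ bd i at h1
    rw [hdot] at h1
    simp only [bd, if_pos] at h1
    rw [hdot]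
    have h2 : |(∑ k, z k * f k : ℤ)| < 1 := by
      have : ((|(∑ k, z k * f k : ℤ)| : ℤ) : ℝ) < 1 := by rw [Int.cast_abs]; linarith
      exact_mod_cast this
    rw [Int.abs_lt_one_iff.mp h2]; simp
  have hcard : (1 : ℝ) ≤ Fintype.card ι := by exact_mod_cast Fintype.card_pos
  rw [pi_norm_le_iff_of_nonneg (by positivity)]
  intro k
  by_cases hki : k = i
  · subst hki
    have h1 : w k * u k = -∑ l ∈ Finset.univ.erase k, w l * u l := by
      rw [dotProduct, ← Finset.add_sum_erase _ _ (Finset.mem_univ k)] at hdot0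
      linarith
    have h2 : |w k| * |u k| ≤ |w k| * (Fintype.card ι * M) := by
      rw [← abs_mul, h1, abs_neg]
      calc _ ≤ ∑ l ∈ Finset.univ.erase k, |w l * u l| := Finset.abs_sum_le_sum_abs _ _
        _ ≤ ∑ l ∈ Finset.univ.erase k, |w k| * M := by
          refine Finset.sum_le_sum fun l hl => ?_
          rw [abs_mul]
          exact mul_le_mul (hi l (Finset.mem_univ l)) (hk l (Finset.ne_of_mem_erase hl))
            (abs_nonneg _) (abs_nonneg _)
        _ ≤ ∑ l : ι, |w k| * M :=
          Finset.sum_le_sum_of_subset_of_nonneg (Finset.erase_subset _ _)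
            (fun _ _ _ => by positivity)
        _ = _ := by simp; ring
    exact le_of_mul_le_mul_left h2 hwi
  · refine (hk k hki).trans ?_
    nlinarith

lemma gm_dual {m n : ℕ} (t : ℝ) (A : Fin m → Fin n → ℝ) :
    (gm m n t A)ᵀ * (gm n m t (fun j i => -A i j)).submatrix Sum.swap Sum.swap = 1 := by
  have e1 : Real.exp (t / m) * Real.exp (-(t / m)) = 1 := by rw [← Real.exp_add]; simp
  have e2 : Real.exp (-(t / n)) * Real.exp (t / n) = 1 := by rw [← Real.exp_add]; simp
  have h1 : (gm n m t (fun j i => -A i j)).submatrix Sum.swap Sum.swap =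
      fromBlocks (Real.exp (-(t / m)) • (1 : Matrix (Fin m) (Fin m) ℝ)) 0
        (-(Real.exp (t / n) • (Matrix.of A)ᵀ)) (Real.exp (t / n) • (1 : Matrix (Fin n) (Fin n) ℝ))
        := by
    ext (i | i) (j | j) <;> simp [gm]
  rw [h1, gm, fromBlocks_transpose, fromBlocks_multiply, ← fromBlocks_one]
  congr 1
  · simp [smul_smul, mul_comm, e1]
  · simp
  · ext i j
    simp [smul_smul]
    linear_combination (A j i) * e1 - (A j i) * e2
  · have e3 : Real.exp (t / n) * Real.exp (-(t / n)) = 1 := by rw [mul_comm]; exact e2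
    simp [smul_smul, e3]

lemma swap_norm {m n : ℕ} (h : Matrix (Fin n ⊕ Fin m) (Fin n ⊕ Fin m) ℝ)
    (z : Fin m ⊕ Fin n → ℤ) :
    ‖h.submatrix Sum.swap Sum.swap *ᵥ ic z‖ = ‖h *ᵥ ic (z ∘ Sum.swap)‖ := by
  have h1 : h.submatrix Sum.swap Sum.swap *ᵥ ic z =
      (h *ᵥ ic (z ∘ Sum.swap)) ∘ (Sum.swap : Fin m ⊕ Fin n → Fin n ⊕ Fin m) := by
    funext i
    simp only [mulVec, dotProduct, submatrix_apply, Function.comp]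
    exact Fintype.sum_equiv (Equiv.sumComm _ _) _ _ (fun x => by simp [ic])
  rw [h1]
  apply le_antisymm
  · rw [pi_norm_le_iff_of_nonneg (norm_nonneg _)]
    intro i
    exact norm_le_pi_norm (h *ᵥ ic (z ∘ Sum.swap)) (Sum.swap i)
  · rw [pi_norm_le_iff_of_nonneg (norm_nonneg _)]
    intro i
    have := norm_le_pi_norm ((h *ᵥ ic (z ∘ Sum.swap)) ∘
      (Sum.swap : Fin m ⊕ Fin n → Fin n ⊕ Fin m)) (Sum.swap i)
    simpa using this

lemma main_one {m n : ℕ} (hm : 0 < m) (hn : 2 ≤ n) (η ε : ℝ) (hη : 0 < η) (hε : 0 < ε) :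
    ∃ ρ : ℝ, 0 < ρ ∧ ∃ tc : ℕ, ENNReal.ofReal ((m : ℝ) * n - (m : ℝ) * n / ((m : ℝ) + n) - ε) ≤
      dimH {A : Fin m → Fin n → ℝ | ∀ t : ℝ, (tc : ℝ) ≤ t →
        (∀ z : Fin m ⊕ Fin n → ℤ, z ≠ 0 → ρ ≤ ‖gm m n t A *ᵥ ic z‖) ∧
        ∃ z : Fin m ⊕ Fin n → ℤ, z ≠ 0 ∧ ‖gm m n t A *ᵥ ic z‖ ≤ η} := by
  have hn0 : 0 < n := by omega
  have : Nonempty (Fin m ⊕ Fin n) := ⟨Sum.inl ⟨0, hm⟩⟩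
  have hmR : (0 : ℝ) < m := by exact_mod_cast hm
  have hnR : (0 : ℝ) < n := by exact_mod_cast hn0
  have hcard : Fintype.card (Fin m ⊕ Fin n) = m + n := by simp
  set d : ℝ := ((Fintype.card (Fin m ⊕ Fin n) : ℕ) : ℝ) with hd
  have hd0 : 0 < d := by rw [hd, hcard]; positivity
  set k := Fintype.card (Fin m ⊕ Fin n) - 1 with hk
  obtain ⟨ρ', hρ', tc, hdim⟩ := main_ge2 hn hm ((η / d) ^ k / 2) ε (by positivity) hε
  refine ⟨(ρ' / (2 * d)) ^ k / 4, by positivity, tc, ?_⟩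
  have hsym : (m : ℝ) * n - (m : ℝ) * n / ((m : ℝ) + n) - ε =
      (n : ℝ) * m - (n : ℝ) * m / ((n : ℝ) + m) - ε := by rw [mul_comm, add_comm]
  rw [hsym]
  refine hdim.trans ?_
  set E := {A : Fin m → Fin n → ℝ | ∀ t : ℝ, (tc : ℝ) ≤ t →
        (∀ z : Fin m ⊕ Fin n → ℤ, z ≠ 0 → (ρ' / (2 * d)) ^ k / 4 ≤ ‖gm m n t A *ᵥ ic z‖) ∧
        ∃ z : Fin m ⊕ Fin n → ℤ, z ≠ 0 ∧ ‖gm m n t A *ᵥ ic z‖ ≤ η} with hE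
  let Ψ : (Fin m → Fin n → ℝ) → (Fin n → Fin m → ℝ) := fun A j i => -A i j
  have hΨ : LipschitzWith 1 Ψ := by
    refine LipschitzWith.of_dist_le_mul fun A B => ?_
    rw [NNReal.coe_one, one_mul, dist_pi_le_iff dist_nonneg]
    intro j
    rw [dist_pi_le_iff dist_nonneg]
    intro i
    simp only [Ψ, dist_neg_neg]
    exact (dist_le_pi_dist (A i) (B i) j).trans (dist_le_pi_dist A B i)
  refine le_trans (dimH_mono ?_) (hΨ.dimH_image_le E)
  intro A' hA'
  let A : Fin m → Fin n → ℝ := fun i j => -A' j i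
  have hΨA : Ψ A = A' := by funext j i; simp [Ψ, A]
  refine ⟨A, ?_, hΨA⟩
  intro t ht
  obtain ⟨hlo, z', hz', hup⟩ := hA' t ht
  set h := (gm n m t A').submatrix (Sum.swap : Fin m ⊕ Fin n → Fin n ⊕ Fin m) Sum.swap with hh
  have hdual : (gm m n t A)ᵀ * h = 1 := by
    have := gm_dual t A
    rw [show (fun j i => -A i j) = A' from hΨA] at this
    exact this
  have hdual2 : hᵀ * gm m n t A = 1 := by
    have := congrArg transpose hdual
    simpa [transpose_mul] using this
  have hhdet : h.det = 1 := by
    have := congrArg det hdual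
    rw [det_mul, det_transpose, gm_det hm hn0, one_mul, det_one] at this
    exact this
  have hsw : ∀ z : Fin m ⊕ Fin n → ℤ, z ≠ 0 → (z ∘ Sum.swap : Fin n ⊕ Fin m → ℤ) ≠ 0 := by
    intro z hz h0
    apply hz
    funext i
    have := congrFun h0 (Sum.swap i)
    simpa using this
  constructor
  · intro z hz
    by_contra hcon
    push Not at hcon
    obtain ⟨f, hf, hfb⟩ := transference h (gm m n t A) hhdet hdual2 ((ρ' / (2 * d)) ^ k / 4)
      (ρ' / (2 * d)) (by positivity) (by
        have : 0 < (ρ' / (2 * d)) ^ k := by positivity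
        rw [← hk]; linarith) z hz hcon.le
    rw [hh, swap_norm, ← hd] at hfb
    have h1 := hlo _ (hsw f hf)
    have h2 : d * (ρ' / (2 * d)) = ρ' / 2 := by field_simp
    linarith
  · obtain ⟨f, hf, hfb⟩ := transference (gm m n t A) h (gm_det hm hn0 _ _) hdual
      ((η / d) ^ k / 2) (η / d) (by positivity) (by rw [← hk]; linarith)
      (z' ∘ Sum.swap) (by
        intro h0
        apply hz'
        funext i
        have := congrFun h0 (Sum.swap i)
        simpa using this) (by
        rw [hh, swap_norm]
        have : (z' ∘ Sum.swap) ∘ Sum.swap = z' := by funext i; simp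
        rw [this]
        exact hup)
    refine ⟨f, hf, hfb.trans (le_of_eq ?_)⟩
    rw [← hd]; field_simp

lemma au_eq (m n : ℕ) (t : ℝ) (A : Fin m → Fin n → ℝ) :
    aMat m n t * uMat m n A = (gm m n t A).submatrix finSumFinEquiv.symm finSumFinEquiv.symm := by
  rw [aMat, uMat, Matrix.reindex_apply, Matrix.reindex_apply, Matrix.submatrix_mul_equiv,
    fromBlocks_multiply, gm]
  simp

lemma reindex_norm {m n : ℕ} (h : Matrix (Fin m ⊕ Fin n) (Fin m ⊕ Fin n) ℝ)
    (v : Fin (m + n) → ℤ) :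
    ‖(h.submatrix finSumFinEquiv.symm finSumFinEquiv.symm).mulVec (fun i => (v i : ℝ))‖ =
      ‖h *ᵥ ic (v ∘ finSumFinEquiv)‖ := by
  have h1 : (h.submatrix finSumFinEquiv.symm finSumFinEquiv.symm).mulVec (fun i => (v i : ℝ)) =
      (h *ᵥ ic (v ∘ finSumFinEquiv)) ∘ finSumFinEquiv.symm := by
    funext i
    simp only [mulVec, dotProduct, submatrix_apply, Function.comp]
    exact Fintype.sum_equiv finSumFinEquiv.symm _ _ (fun x => by simp [ic])
  rw [h1]
  apply le_antisymm
  · rw [pi_norm_le_iff_of_nonneg (norm_nonneg _)]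
    intro i
    exact norm_le_pi_norm (h *ᵥ ic (v ∘ finSumFinEquiv)) (finSumFinEquiv.symm i)
  · rw [pi_norm_le_iff_of_nonneg (norm_nonneg _)]
    intro i
    have := norm_le_pi_norm ((h *ᵥ ic (v ∘ finSumFinEquiv)) ∘ finSumFinEquiv.symm)
      (finSumFinEquiv i)
    simpa using this

lemma lam1M_bounds {m n : ℕ} {ρ η t : ℝ} {A : Fin m → Fin n → ℝ}
    (hlo : ∀ z : Fin m ⊕ Fin n → ℤ, z ≠ 0 → ρ ≤ ‖gm m n t A *ᵥ ic z‖)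
    (hup : ∃ z : Fin m ⊕ Fin n → ℤ, z ≠ 0 ∧ ‖gm m n t A *ᵥ ic z‖ ≤ η) :
    ρ ≤ lam1M (m + n) (aMat m n t * uMat m n A) ∧
      lam1M (m + n) (aMat m n t * uMat m n A) ≤ η := by
  obtain ⟨z, hz, hzη⟩ := hup
  have hmem : η ∈ {r : ℝ | ∃ v : Fin (m + n) → ℤ, v ≠ 0 ∧
      ‖(aMat m n t * uMat m n A).mulVec (fun i => (v i : ℝ))‖ ≤ r} := by
    refine ⟨z ∘ finSumFinEquiv.symm, ?_, ?_⟩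
    · intro h0
      apply hz
      funext i
      have := congrFun h0 (finSumFinEquiv i)
      simpa using this
    · rw [au_eq, reindex_norm]
      have : (z ∘ finSumFinEquiv.symm) ∘ finSumFinEquiv = z := by funext i; simp
      rw [this]
      exact hzη
  have hlb : ∀ r ∈ {r : ℝ | ∃ v : Fin (m + n) → ℤ, v ≠ 0 ∧
      ‖(aMat m n t * uMat m n A).mulVec (fun i => (v i : ℝ))‖ ≤ r}, ρ ≤ r := by
    rintro r ⟨v, hv, hvr⟩
    rw [au_eq, reindex_norm] at hvr
    refine (hlo _ ?_).trans hvr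
    intro h0
    apply hv
    funext i
    have := congrFun h0 (finSumFinEquiv.symm i)
    simpa using this
  exact ⟨le_csInf ⟨η, hmem⟩ hlb, csInf_le ⟨ρ, hlb⟩ hmem⟩

/-- **Proposition 2.4.** Suppose `(m,n) ≠ (1,1)`. For any `ε > 0` there are `ρ_ε, η_ε > 0` and
`t_ε ∈ ℕ` such that the set of matrices `A` with `ρ_ε ≤ λ₁(a_t u_A ℤ^d) ≤ η_ε` for all
`t ≥ t_ε` has Hausdorff dimension at least `mn - mn/(m+n) - ε`; moreover `ρ_ε, η_ε → 0`
as `ε → 0`. -/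
theorem prop_dim (m n : ℕ) (hm : 0 < m) (hn : 0 < n) (hmn : (m, n) ≠ (1, 1)) :
    ∃ ρ η : ℝ → ℝ, ∃ tc : ℝ → ℕ,
      (∀ ε : ℝ, 0 < ε →
        0 < ρ ε ∧ 0 < η ε ∧
        ENNReal.ofReal ((m : ℝ) * n - (m : ℝ) * n / ((m : ℝ) + n) - ε) ≤
          dimH {A : Fin m → Fin n → ℝ | ∀ t : ℝ, (tc ε : ℝ) ≤ t →
            ρ ε ≤ lam1M (m + n) (aMat m n t * uMat m n A) ∧
            lam1M (m + n) (aMat m n t * uMat m n A) ≤ η ε}) ∧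
      Tendsto ρ (𝓝[>] (0 : ℝ)) (𝓝 0) ∧ Tendsto η (𝓝[>] (0 : ℝ)) (𝓝 0) := by
  have key : ∀ ε : ℝ, ∃ ρ : ℝ, ∃ tc : ℕ, 0 < ε → 0 < ρ ∧ ρ ≤ ε ∧
      ENNReal.ofReal ((m : ℝ) * n - (m : ℝ) * n / ((m : ℝ) + n) - ε) ≤
          dimH {A : Fin m → Fin n → ℝ | ∀ t : ℝ, (tc : ℝ) ≤ t →
            ρ ≤ lam1M (m + n) (aMat m n t * uMat m n A) ∧
            lam1M (m + n) (aMat m n t * uMat m n A) ≤ ε} := by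
    intro ε
    by_cases hε : 0 < ε
    swap
    · exact ⟨0, 0, fun h => absurd h hε⟩
    have hmain : ∃ ρ : ℝ, 0 < ρ ∧ ∃ tc : ℕ,
        ENNReal.ofReal ((m : ℝ) * n - (m : ℝ) * n / ((m : ℝ) + n) - ε) ≤
        dimH {A : Fin m → Fin n → ℝ | ∀ t : ℝ, (tc : ℝ) ≤ t →
          (∀ z : Fin m ⊕ Fin n → ℤ, z ≠ 0 → ρ ≤ ‖gm m n t A *ᵥ ic z‖) ∧
          ∃ z : Fin m ⊕ Fin n → ℤ, z ≠ 0 ∧ ‖gm m n t A *ᵥ ic z‖ ≤ ε} := by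
      by_cases h2 : 2 ≤ m
      · exact main_ge2 h2 hn ε ε hε hε
      · refine main_one hm ?_ ε ε hε hε
        by_contra h3
        apply hmn
        have h4 : m = 1 := by omega
        have h5 : n = 1 := by omega
        rw [h4, h5]
    obtain ⟨ρ, hρ, tc, hdim⟩ := hmain
    refine ⟨min ρ ε, tc, fun _ => ⟨lt_min hρ hε, min_le_right _ _, hdim.trans (dimH_mono ?_)⟩⟩
    intro A hA t ht
    obtain ⟨h1, h2⟩ := hA t ht
    exact lam1M_bounds (fun z hz => (min_le_left _ _).trans (h1 z hz)) h2
  choose ρ tc hk using key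
  refine ⟨ρ, fun ε => ε, tc, fun ε hε => ⟨(hk ε hε).1, hε, (hk ε hε).2.2⟩, ?_, ?_⟩
  · have hid : Tendsto (fun ε : ℝ => ε) (𝓝[>] (0 : ℝ)) (𝓝 0) := nhdsWithin_le_nhds
    refine tendsto_of_tendsto_of_tendsto_of_le_of_le' tendsto_const_nhds hid ?_ ?_
    · filter_upwards [self_mem_nhdsWithin] with ε hε
      exact (hk ε hε).1.le
    · filter_upwards [self_mem_nhdsWithin] with ε hε
      exact (hk ε hε).2.1
  · exact nhdsWithin_le_nhds
end
end

section
/- Let (X, ℬ) be a standard Borel space, T : X → X a measurable map, ν a Borel probability measure on X (not necessarily T-invariant), and 𝒫 a finite measurable partition of X. For integers N ≥ q ≥ 1, write 𝒫^(q) = ⋁_{k=0}^{q−1} T^{−k}𝒫 and let μ_N = (1/N) Σ_{k=0}^{N−1} T^k_* ν be the Cesàro average of the pushforwards of ν. Then (1/q) H_{μ_N}(𝒫^(q)) ≥ (1/N) H_ν(𝒫^(N)) − 2q log|𝒫| / N, where H_μ(𝒬) = −Σ_{Q∈𝒬} μ(Q) log μ(Q) denotes the Shannon entropy of the partition 𝒬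 with respect to μ. -/
open MeasureTheory Matrix ENNReal Filter Topology

noncomputable section

/-- Gibbs inequality. -/
lemma gibbs_aux {S : Type*} [Fintype S] (p r : S → ℝ) (hp : ∀ s, 0 ≤ p s) (hr : ∀ s, 0 ≤ r s)
    (h0 : ∀ s, r s = 0 → p s = 0) (hsum : ∑ s, r s ≤ ∑ s, p s) :
    ∑ s, Real.negMulLog (p s) ≤ ∑ s, -(p s * Real.log (r s)) := by
  have key : ∀ s, Real.negMulLog (p s) ≤ -(p s * Real.log (r s)) + (r s - p s) := by
    intro s
    rcases (hp s).eq_or_lt with h | h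
    · rw [← h]; simpa using hr s
    · have hrs : 0 < r s := lt_of_le_of_ne (hr s) (fun e => h.ne' (h0 s e.symm))
      have h1 := Real.log_le_sub_one_of_pos (div_pos hrs h)
      rw [Real.log_div hrs.ne' h.ne'] at h1
      have h2 := mul_le_mul_of_nonneg_left h1 h.le
      have h3 : p s * (r s / p s - 1) = r s - p s := by field_simp
      rw [h3] at h2
      rw [Real.negMulLog]
      linarith
  have := Finset.sum_le_sum (fun s (_ : s ∈ Finset.univ) => key s)
  rw [Finset.sum_add_distrib, Finset.sum_sub_distrib] at this
  linarith

/-- Entropy of a finite-valued function. -/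
def entFun {X S : Type*} [MeasurableSpace X] [Fintype S] (ν : Measure X) (g : X → S) : ℝ :=
  ∑ s, Real.negMulLog (ν (g ⁻¹' {s})).toReal

section
variable {X A B : Type*} [MeasurableSpace X] [Fintype A] [Fintype B]
  (ν : Measure X) [IsProbabilityMeasure ν]

lemma entFun_sum (g : X → A) (hg : ∀ a, MeasurableSet (g ⁻¹' {a})) (s : Set X)
    (hs : MeasurableSet s) :
    ∑ a, (ν (s ∩ g ⁻¹' {a})).toReal = (ν s).toReal := by
  rw [← ENNReal.toReal_sum (fun _ _ => measure_ne_top _ _), ← measure_biUnion_finset]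
  · congr 2
    ext x; simp
  · intro a _ b _ hab
    refine Set.disjoint_left.2 ?_
    rintro x ⟨_, h1⟩ ⟨_, h2⟩
    exact hab (h1.symm.trans h2)
  · intro a _
    exact hs.inter (hg a)

lemma entFun_sum_univ (g : X → A) (hg : ∀ a, MeasurableSet (g ⁻¹' {a})) :
    ∑ a, (ν (g ⁻¹' {a})).toReal = 1 := by
  have := entFun_sum ν g hg Set.univ MeasurableSet.univ
  simpa using this

lemma entFun_nonneg (g : X → A) : 0 ≤ entFun ν g :=
  Finset.sum_nonneg fun _ _ => Real.negMulLog_nonneg ENNReal.toReal_nonneg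
    (by simpa using ENNReal.toReal_mono ENNReal.one_ne_top (prob_le_one (μ := ν)))

lemma entFun_le_log (g : X → A) (hg : ∀ a, MeasurableSet (g ⁻¹' {a})) :
    entFun ν g ≤ Real.log (Fintype.card A) := by
  have hs := entFun_sum_univ ν g hg
  have hc : (Fintype.card A : ℝ) ≠ 0 := by
    intro h
    have : IsEmpty A := Fintype.card_eq_zero_iff.1 (by exact_mod_cast h)
    simp at hs
  refine (gibbs_aux (fun a => (ν (g ⁻¹' {a})).toReal) (fun _ => (Fintype.card A : ℝ)⁻¹)
    (fun _ => ENNReal.toReal_nonneg) (fun _ => by positivity) ?_ ?_).trans ?_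
  · intro s h
    exact absurd h (inv_ne_zero hc)
  · rw [hs]; simp [hc]
  · simp only [Real.log_inv, mul_neg, neg_neg]
    rw [← Finset.sum_mul, hs, one_mul]

lemma entFun_pair (g : X → A) (h : X → B) (hg : ∀ a, MeasurableSet (g ⁻¹' {a}))
    (hh : ∀ a, MeasurableSet (h ⁻¹' {a})) :
    entFun ν (fun x => (g x, h x)) ≤ entFun ν g + entFun ν h := by
  have hpre : ∀ a b, (fun x => (g x, h x)) ⁻¹' {(a, b)} = g ⁻¹' {a} ∩ h ⁻¹' {b} := by
    intro a b; ext x; simp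
  have hga := entFun_sum_univ ν g hg
  have hhb := entFun_sum_univ ν h hh
  have m1 : ∀ a, ∑ b, (ν (g ⁻¹' {a} ∩ h ⁻¹' {b})).toReal = (ν (g ⁻¹' {a})).toReal :=
    fun a => entFun_sum ν h hh _ (hg a)
  have m2 : ∀ b, ∑ a, (ν (g ⁻¹' {a} ∩ h ⁻¹' {b})).toReal = (ν (h ⁻¹' {b})).toReal := by
    intro b
    rw [← entFun_sum ν g hg _ (hh b)]
    simp only [Set.inter_comm]
  have z1 : ∀ a b, (ν (g ⁻¹' {a})).toReal = 0 → (ν (g ⁻¹' {a} ∩ h ⁻¹' {b})).toReal = 0 :=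
    fun a b e => le_antisymm (e ▸ ENNReal.toReal_mono (measure_ne_top _ _)
      (measure_mono Set.inter_subset_left)) ENNReal.toReal_nonneg
  have z2 : ∀ a b, (ν (h ⁻¹' {b})).toReal = 0 → (ν (g ⁻¹' {a} ∩ h ⁻¹' {b})).toReal = 0 :=
    fun a b e => le_antisymm (e ▸ ENNReal.toReal_mono (measure_ne_top _ _)
      (measure_mono Set.inter_subset_right)) ENNReal.toReal_nonneg
  unfold entFun
  have hG := gibbs_aux (S := A × B) (fun s => (ν (g ⁻¹' {s.1} ∩ h ⁻¹' {s.2})).toReal)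
    (fun s => (ν (g ⁻¹' {s.1})).toReal * (ν (h ⁻¹' {s.2})).toReal)
    (fun _ => ENNReal.toReal_nonneg) (fun _ => by positivity) (by
      intro s hs
      rcases mul_eq_zero.1 hs with e | e
      · exact z1 _ _ e
      · exact z2 _ _ e) (by
      rw [Fintype.sum_prod_type, Fintype.sum_prod_type]
      simp only [← Finset.mul_sum, hhb, m1, hga, mul_one, le_refl])
  have hL : ∑ s : A × B, Real.negMulLog (ν ((fun x => (g x, h x)) ⁻¹' {s})).toReal
      = ∑ s : A × B, Real.negMulLog (ν (g ⁻¹' {s.1} ∩ h ⁻¹' {s.2})).toReal :=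
    Finset.sum_congr rfl fun s _ => by rw [← hpre]
  rw [hL]
  refine hG.trans (le_of_eq ?_)
  have hsplit : ∀ s : A × B, -((ν (g ⁻¹' {s.1} ∩ h ⁻¹' {s.2})).toReal *
        Real.log ((ν (g ⁻¹' {s.1})).toReal * (ν (h ⁻¹' {s.2})).toReal))
      = -((ν (g ⁻¹' {s.1} ∩ h ⁻¹' {s.2})).toReal * Real.log (ν (g ⁻¹' {s.1})).toReal)
        + -((ν (g ⁻¹' {s.1} ∩ h ⁻¹' {s.2})).toReal * Real.log (ν (h ⁻¹' {s.2})).toReal) := by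
    intro s
    by_cases e1 : (ν (g ⁻¹' {s.1})).toReal = 0
    · rw [z1 _ s.2 e1]; simp
    by_cases e2 : (ν (h ⁻¹' {s.2})).toReal = 0
    · rw [z2 s.1 _ e2]; simp
    rw [Real.log_mul e1 e2]; ring
  rw [Finset.sum_congr rfl fun s _ => hsplit s, Finset.sum_add_distrib]
  congr 1
  · rw [Fintype.sum_prod_type]
    refine Finset.sum_congr rfl fun a _ => ?_
    simp only [Finset.sum_neg_distrib, ← Finset.sum_mul, m1, Real.negMulLog, neg_mul]
  · rw [Fintype.sum_prod_type_right]
    refine Finset.sum_congr rfl fun a _ => ?_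
    simp only [Finset.sum_neg_distrib, ← Finset.sum_mul, m2, Real.negMulLog, neg_mul]

lemma entFun_equiv (e : A ≃ B) (g : X → A) : entFun ν (fun x => e (g x)) = entFun ν g := by
  unfold entFun
  rw [← Equiv.sum_comp e]
  refine Finset.sum_congr rfl fun a _ => ?_
  congr 3
  ext x; simp
end

/-- Combinatorial block-counting step. -/
lemma block_count (h : ℕ → ℕ → ℝ) (L : ℝ) (hL : 0 ≤ L) (h0 : ∀ a n, 0 ≤ h a n)
    (hle : ∀ a n, h a n ≤ n * L) (hsub : ∀ a n m, h a (n + m) ≤ h a n + h (a + n) m)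
    (N q : ℕ) (hq : 1 ≤ q) (hNq : q ≤ N) :
    q * h 0 N ≤ ∑ j ∈ Finset.range N, h j q + 2 * q * q * L := by
  have hblocks : ∀ a m, h a (m * q) ≤ ∑ i ∈ Finset.range m, h (a + i * q) q := by
    intro a m
    induction m with
    | zero => simpa using hle a 0
    | succ m ih =>
      rw [Finset.sum_range_succ, Nat.succ_mul]
      exact (hsub _ _ _).trans (by gcongr)
  have hr : ∀ r ∈ Finset.range q, h 0 N ≤
      ∑ j ∈ (Finset.range N).filter (fun j => j % q = r), h j q + 2 * q * L := by
    intro r hr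
    have hrq : r < q := Finset.mem_range.1 hr
    set m := (N - r) / q with hm
    set t := (N - r) % q with ht
    have htq : t < q := Nat.mod_lt _ (by omega)
    have hdm : m * q + t = N - r := by rw [mul_comm]; exact Nat.div_add_mod _ _
    have hN : N = r + (m * q + t) := by omega
    have e1 : h 0 N ≤ h 0 r + (h r (m * q) + h (r + m * q) t) := by
      conv_lhs => rw [hN]
      refine (hsub 0 r _).trans ?_
      rw [zero_add]
      gcongr
      exact hsub _ _ _
    have e2 : h 0 r ≤ q * L := (hle _ _).trans (by gcongr)
    have e3 : h (r + m * q) t ≤ q * L := (hle _ _).trans (by gcongr)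
    have e4 : ∑ i ∈ Finset.range m, h (r + i * q) q ≤
        ∑ j ∈ (Finset.range N).filter (fun j => j % q = r), h j q := by
      rw [← Finset.sum_image (f := fun j => h j q) (g := fun i => r + i * q)]
      · refine Finset.sum_le_sum_of_subset_of_nonneg ?_ (fun _ _ _ => h0 _ _)
        intro j hj
        obtain ⟨i, hi, rfl⟩ := Finset.mem_image.1 hj
        have hi' : i + 1 ≤ m := Finset.mem_range.1 hi
        have := Nat.mul_le_mul_right q hi'
        rw [Nat.succ_mul] at this
        simp only [Finset.mem_filter, Finset.mem_range]
        refine ⟨by omega, ?_⟩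
        rw [Nat.add_mul_mod_self_right, Nat.mod_eq_of_lt hrq]
      · intro i _ j _ hij
        have : i * q = j * q := by simpa using hij
        exact Nat.eq_of_mul_eq_mul_right (by omega) this
    have := hblocks r m
    linarith
  have hs := Finset.sum_le_sum hr
  rw [Finset.sum_add_distrib, Finset.sum_fiberwise_of_maps_to] at hs
  · simp only [Finset.sum_const, Finset.card_range, nsmul_eq_mul] at hs
    linarith
  · intro j _
    exact Finset.mem_range.2 (Nat.mod_lt _ (by omega))

/-- **Entropy inequality for Cesàro averages.** For a measurable map `T` on a standard Borel
space, a Borel probability measure `ν` (not necessarily invariant), a finite measurable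
partition `P` with `K` atoms, and `N ≥ q ≥ 1`:
`(1/q) H_{μ_N}(P^{(q)}) ≥ (1/N) H_ν(P^{(N)}) - 2q log K / N`,
where `μ_N = (1/N) ∑_{j<N} T^j_* ν`. -/
theorem entropy_cesaro_bound {X : Type*} [MeasurableSpace X] [StandardBorelSpace X]
    (T : X → X) (hT : Measurable T)
    (ν : Measure X) (hν : IsProbabilityMeasure ν)
    (K : ℕ) (P : Fin K → Set X) (hP : IsFinPart P)
    (N q : ℕ) (hq : 1 ≤ q) (hNq : q ≤ N) :
    (1 / (N : ℝ)) * partEnt ν (joinPart T P N) - 2 * q * Real.log K / N ≤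
      (1 / (q : ℝ)) *
        partEnt ((N : ℝ≥0∞)⁻¹ • ∑ j ∈ Finset.range N, Measure.map (T^[j]) ν)
          (joinPart T P q) := by
  classical
  obtain ⟨hPm, hPd, hPu⟩ := hP
  have hex : ∀ x, ∃ i, x ∈ P i := fun x => by
    have : x ∈ ⋃ i, P i := hPu ▸ Set.mem_univ x
    simpa using this
  choose f hf using hex
  have hfP : ∀ x i, x ∈ P i ↔ f x = i := by
    intro x i
    constructor
    · intro hx
      by_contra hne
      exact Set.disjoint_left.1 (hPd hne) (hf x) hx
    · rintro rfl; exact hf x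
  have hfm : Measurable f := by
    refine measurable_to_countable' fun i => ?_
    have : f ⁻¹' {i} = P i := by ext x; simp [hfP]
    rw [this]; exact hPm i
  have hK : 0 < K := by
    obtain ⟨x⟩ : Nonempty X := nonempty_of_isProbabilityMeasure ν
    exact (f x).pos
  have hL : 0 ≤ Real.log K := Real.log_natCast_nonneg K
  -- words
  let V : ∀ n : ℕ, ℕ → X → (Fin n → Fin K) := fun n a x j => f (T^[a + j] x)
  have hVm : ∀ n a, Measurable (V n a) := fun n a =>
    measurable_pi_lambda _ fun j => hfm.comp (hT.iterate _)
  have hVs : ∀ n a s, MeasurableSet (V n a ⁻¹' {s}) := fun n a s =>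
    hVm n a (measurableSet_singleton s)
  have hjoin : ∀ n a ω, T^[a] ⁻¹' (joinPart T P n ω) = V n a ⁻¹' {ω} := by
    intro n a ω
    ext x
    simp only [joinPart, Set.mem_preimage, Set.mem_iInter, hfP, Set.mem_singleton_iff, V,
      funext_iff]
    refine forall_congr' fun j => ?_
    rw [← Function.iterate_add_apply, add_comm]
  have hjm : ∀ n ω, MeasurableSet (joinPart T P n ω) := fun n ω => by
    have := hjoin n 0 ω
    simp only [Function.iterate_zero, Set.preimage_id] at this
    rw [this]; exact hVs _ _ _
  let h : ℕ → ℕ → ℝ := fun a n => entFun ν (V n a)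
  have hb := block_count h (Real.log K) hL (fun a n => entFun_nonneg ν _)
    (fun a n => by
      have := entFun_le_log ν (V n a) (hVs n a)
      simpa using this)
    (fun a n m => by
      have h1 := entFun_pair ν (V n a) (V m (a + n)) (hVs _ _) (hVs _ _)
      rw [← entFun_equiv ν (Fin.appendEquiv n m)] at h1
      have h2 : (fun x => Fin.appendEquiv n m (V n a x, V m (a + n) x)) = V (n + m) a := by
        funext x j
        refine Fin.addCases (fun i => ?_) (fun i => ?_) j
        · simp [V, Fin.appendEquiv]
        · simp [V, Fin.appendEquiv, add_assoc]
      rw [h2] at h1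
      exact h1) N q hq hNq
  have hN0 : (0 : ℝ) < N := by exact_mod_cast (by omega : 0 < N)
  have hq0 : (0 : ℝ) < q := by exact_mod_cast (by omega : 0 < q)
  have hleft : partEnt ν (joinPart T P N) = h 0 N := by
    refine Finset.sum_congr rfl fun ω _ => ?_
    rw [← hjoin]; simp
  have hright : (N : ℝ)⁻¹ * ∑ j ∈ Finset.range N, h j q ≤
      partEnt ((N : ℝ≥0∞)⁻¹ • ∑ j ∈ Finset.range N, Measure.map (T^[j]) ν)
          (joinPart T P q) := by
    have : ∑ j ∈ Finset.range N, h j q = ∑ ω : Fin q → Fin K, ∑ j ∈ Finset.range N,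
        Real.negMulLog (ν (V q j ⁻¹' {ω})).toReal := Finset.sum_comm
    rw [this, Finset.mul_sum]
    refine Finset.sum_le_sum fun ω _ => ?_
    have hmeas : (((N : ℝ≥0∞)⁻¹ • ∑ j ∈ Finset.range N, Measure.map (T^[j]) ν)
        (joinPart T P q ω)).toReal
        = ∑ j ∈ Finset.range N, (N : ℝ)⁻¹ • (ν (V q j ⁻¹' {ω})).toReal := by
      rw [Measure.smul_apply, Measure.finsetSum_apply, smul_eq_mul, ENNReal.toReal_mul,
        ENNReal.toReal_inv, ENNReal.toReal_natCast, ← Finset.smul_sum, smul_eq_mul]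
      congr 1
      have e : ∀ j ∈ Finset.range N, Measure.map (T^[j]) ν (joinPart T P q ω)
          = ν (V q j ⁻¹' {ω}) := fun j _ => by
        rw [Measure.map_apply (hT.iterate _) (hjm _ _), hjoin]
      rw [Finset.sum_congr rfl e, ENNReal.toReal_sum (fun _ _ => measure_ne_top _ _)]
    rw [hmeas, Finset.mul_sum]
    have := Real.concaveOn_negMulLog.le_map_sum (t := Finset.range N)
      (w := fun _ => (N : ℝ)⁻¹) (p := fun j => (ν (V q j ⁻¹' {ω})).toReal)
      (fun _ _ => by positivity) (by simp [hN0.ne'])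
      (fun _ _ => Set.mem_Ici.2 ENNReal.toReal_nonneg)
    simpa only [smul_eq_mul] using this
  rw [hleft]
  refine le_trans ?_ (mul_le_mul_of_nonneg_left hright (by positivity))
  have : 1 / (N : ℝ) * h 0 N - 2 * q * Real.log K / N
      = (1 / q) * ((N : ℝ)⁻¹ * (q * h 0 N - 2 * q * q * Real.log K)) := by
    field_simp
  rw [this]
  gcongr
  linarith
end
end
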